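/- Let {M_n} be a family of sets of states satisfying properties 1–5 on the tensor powers of a finite-dimensional Hilbert space ℋ, and let ρ ∈ D(ℋ). Then for every ε > 0 there exists a sequence of operators {A_n}, with 0 ≤ A_n ≤ I acting on ℋ^{⊗n}, such that lim_{n→∞} tr((I − A_n) ρ^{⊗n}) = 0 and, for every n and every ω_n ∈ M_n, −(1/n) log₂ tr(A_n ω_n) + ε ≥ E_M^∞(ρ). (Direct part of the generalized quantum Stein's Lemma.) -/

import Mathlib

open scoped BigOperators
open Filter ComplexOrder

noncomputable section

namespace GQSL

variable {I : Type*} [Fintype I] [DecidableEq I]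

/-- A quantum state: a positive semidefinite matrix of unit trace. -/
def IsState (ρ : Matrix I I ℂ) : Prop := ρ.PosSemidef ∧ ρ.trace = 1

/-- The `n`-fold tensor power of an operator, realized on `Fin n → I` indices. -/
def tpow (ρ : Matrix I I ℂ) (n : ℕ) : Matrix (Fin n → I) (Fin n → I) ℂ :=
  fun x y => ∏ i, ρ (x i) (y i)

/-- Functional calculus for Hermitian matrices (junk value `0` otherwise). -/
def fcal (f : ℝ → ℝ) (A : Matrix I I ℂ) : Matrix I I ℂ :=
  if hA : A.IsHermitian then
    (hA.eigenvectorUnitary : Matrix I I ℂ) *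
      Matrix.diagonal (fun i => (f (hA.eigenvalues i) : ℂ)) *
      star (hA.eigenvectorUnitary : Matrix I I ℂ)
  else 0

/-- Base-2 matrix logarithm, computed on the support. -/
def mlog (A : Matrix I I ℂ) : Matrix I I ℂ :=
  fcal (fun x => if 0 < x then Real.logb 2 x else 0) A

/-- Real matrix power, computed on the support (generalized inverse powers). -/
def mpow (A : Matrix I I ℂ) (t : ℝ) : Matrix I I ℂ :=
  fcal (fun x => if 0 < x then x ^ t else 0) A

/-- Matrix square root of a positive semidefinite matrix. -/
def msqrt (A : Matrix I I ℂ) : Matrix I I ℂ := fcal Real.sqrt A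

/-- Trace norm `‖A‖₁ = tr √(AᴴA)`. -/
def trNorm (A : Matrix I I ℂ) : ℝ := ((msqrt (A.conjTranspose * A)).trace).re

/-- Trace of the positive part of a Hermitian matrix: the sum of its positive eigenvalues. -/
def trPos (A : Matrix I I ℂ) : ℝ := ((fcal (fun x => max x 0) A).trace).re

/-- Fidelity `F(A,B) = tr √(√A B √A)`. -/
def fid (A B : Matrix I I ℂ) : ℝ := ((msqrt (msqrt A * B * msqrt A)).trace).re

/-- Von Neumann entropy (base 2). -/
def vnEnt (A : Matrix I I ℂ) : ℝ := -((A * mlog A).trace).re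

/-- `supp ρ ⊆ supp σ`, expressed via kernels. -/
def SuppLe (ρ σ : Matrix I I ℂ) : Prop := ∀ v, σ.mulVec v = 0 → ρ.mulVec v = 0

/-- Quantum relative entropy `S(ρ‖σ) = tr(ρ(log₂ρ − log₂σ))` (finite-value formula,
meaningful when `SuppLe ρ σ` holds). -/
def relEnt (ρ σ : Matrix I I ℂ) : ℝ := ((ρ * (mlog ρ - mlog σ)).trace).re

/-- `E_M(ρ) = inf {S(ρ‖σ) : σ ∈ M}`; states `σ` violating the support condition
have `S(ρ‖σ) = +∞` and hence do not contribute to the infimum. -/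
def EMset (M : Set (Matrix I I ℂ)) (ρ : Matrix I I ℂ) : ℝ :=
  sInf {x | ∃ σ ∈ M, SuppLe ρ σ ∧ x = relEnt ρ σ}

/-- Max-relative entropy `S_max(ρ‖σ) = inf {s : ρ ≤ 2^s σ}`. -/
def Smax (ρ σ : Matrix I I ℂ) : ℝ := sInf {s : ℝ | (((2:ℝ) ^ s) • σ - ρ).PosSemidef}

/-- Log robustness with respect to a set `M`. -/
def LR (M : Set (Matrix I I ℂ)) (ρ : Matrix I I ℂ) : ℝ :=
  sInf {x | ∃ σ ∈ M, x = Smax ρ σ}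

/-- Smoothed log robustness. -/
def LReps (M : Set (Matrix I I ℂ)) (ε : ℝ) (ρ : Matrix I I ℂ) : ℝ :=
  sInf {x | ∃ ρ', IsState ρ' ∧ trNorm (ρ' - ρ) ≤ ε ∧ x = LR M ρ'}

/-- Partial trace over the `k`-th tensor factor. -/
def ptraceAt {n : ℕ} (k : Fin (n + 1)) (ρ : Matrix (Fin (n + 1) → I) (Fin (n + 1) → I) ℂ) :
    Matrix (Fin n → I) (Fin n → I) ℂ :=
  fun x y => ∑ a : I, ρ (k.insertNth a x) (k.insertNth a y)

/-- Tensor product of operators on `n` and `m` copies. -/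
def tprod {n m : ℕ} (ρ : Matrix (Fin n → I) (Fin n → I) ℂ)
    (ν : Matrix (Fin m → I) (Fin m → I) ℂ) :
    Matrix (Fin (n + m) → I) (Fin (n + m) → I) ℂ :=
  fun x y => ρ (fun i => x (Fin.castAdd m i)) (fun i => y (Fin.castAdd m i)) *
    ν (fun j => x (Fin.natAdd n j)) (fun j => y (Fin.natAdd n j))

/-- Conjugation `P_π ρ P_π†` by the permutation unitary. -/
def permute {n : ℕ} (π : Equiv.Perm (Fin n)) (ρ : Matrix (Fin n → I) (Fin n → I) ℂ) :
    Matrix (Fin n → I) (Fin n → I) ℂ :=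
  fun x y => ρ (x ∘ π) (y ∘ π)

/-- A family of sets of states satisfying properties 1–5, with `σ` the fixed
full-rank state of property 2. -/
structure GoodFamily {d : ℕ} (σ : Matrix (Fin d) (Fin d) ℂ)
    (M : ∀ n : ℕ, Set (Matrix (Fin n → Fin d) (Fin n → Fin d) ℂ)) : Prop where
  states : ∀ n, ∀ ρ ∈ M n, IsState ρ
  convex : ∀ n, Convex ℝ (M n)
  closed : ∀ n, IsClosed (M n)
  sigma_state : IsState σ
  sigma_posdef : σ.PosDef
  sigma_mem : ∀ n, tpow σ n ∈ M n
  ptrace_mem : ∀ n (k : Fin (n + 1)), ∀ ρ ∈ M (n + 1), ptraceAt k ρ ∈ M n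
  tprod_mem : ∀ n m, ∀ ρ ∈ M n, ∀ ν ∈ M m, tprod ρ ν ∈ M (n + m)
  perm_mem : ∀ n (π : Equiv.Perm (Fin n)), ∀ ρ ∈ M n, permute π ρ ∈ M n

/-- The rank-one operator `|f⟩⟨f|`. -/
def vecOp {J : Type*} (f : J → ℂ) : Matrix J J ℂ := fun x y => f x * star (f y)

/-- Squared ℓ²-norm of a vector. -/
def vecNormSq {J : Type*} [Fintype J] (f : J → ℂ) : ℝ := ∑ x, Complex.normSq (f x)

/-- ℓ²-norm of a vector. -/
def l2norm {J : Type*} [Fintype J] (f : J → ℂ) : ℝ := Real.sqrt (vecNormSq f)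

/-- Membership in the symmetric subspace. -/
def IsSymVec {J : Type*} {N : ℕ} (f : (Fin N → J) → ℂ) : Prop :=
  ∀ (π : Equiv.Perm (Fin N)) (x : Fin N → J), f (x ∘ π) = f x

/-- Unnormalized symmetrization `Σ_π P_π ψ`. -/
def symmetrize {J : Type*} {N : ℕ} (ψ : (Fin N → J) → ℂ) : (Fin N → J) → ℂ :=
  fun x => ∑ π : Equiv.Perm (Fin N), ψ (x ∘ π)

/-- Normalized symmetrization `Sym(ψ)`. -/
def SymOf {J : Type*} [Fintype J] {N : ℕ} (ψ : (Fin N → J) → ℂ) : (Fin N → J) → ℂ :=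
  ((l2norm (symmetrize ψ) : ℂ))⁻¹ • symmetrize ψ

/-- Partial trace over the first `m` of `m + k` tensor factors. -/
def ptraceFirst {J : Type*} [Fintype J] [DecidableEq J] {m k : ℕ}
    (ρ : Matrix (Fin (m + k) → J) (Fin (m + k) → J) ℂ) :
    Matrix (Fin k → J) (Fin k → J) ℂ :=
  fun x y => ∑ a : Fin m → J, ρ (Fin.append a x) (Fin.append a y)

/-- Partial trace over the environment components of `N` system–environment pairs. -/
def ptraceE {A E : Type*} [Fintype A] [Fintype E] {N : ℕ}
    (ρ : Matrix (Fin N → A × E) (Fin N → A × E) ℂ) :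
    Matrix (Fin N → A) (Fin N → A) ℂ :=
  fun x y => ∑ e : Fin N → E, ρ (fun i => (x i, e i)) (fun i => (y i, e i))

/-- The set of `(N choose r)`-i.i.d. vectors along `θ`: vectors which are `θ` on
`N − r` of the positions (the permutations of `θ^{⊗(N−r)} ⊗ ψ_r`). -/
def powVecSet {J : Type*} (θ : J → ℂ) (N r : ℕ) : Set ((Fin N → J) → ℂ) :=
  {f | ∃ S : Finset (Fin N), S.card = N - r ∧
    ∃ ψ : ({i : Fin N // i ∉ S} → J) → ℂ,
      f = fun x => (∏ i ∈ S, θ (x i)) * ψ (fun j => x j.1)}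

/-- Almost power states along `θ`: `|θ⟩^{[⊗,N,r]} = Sym(ℋ^{⊗N}) ∩ span V(ℋ^{⊗N}, θ^{⊗N−r})`. -/
def almostPower {J : Type*} (θ : J → ℂ) (N r : ℕ) : Set ((Fin N → J) → ℂ) :=
  {f | IsSymVec f ∧ f ∈ Submodule.span ℂ (powVecSet θ N r)}

/-- `η ⊗ θ^{⊗(N−k)}`: the vector `η` on the first `k` slots and `θ` on the rest. -/
def etaTensor {J : Type*} {N k : ℕ} (h : k ≤ N) (η : (Fin k → J) → ℂ) (θ : J → ℂ) :
    (Fin N → J) → ℂ :=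
  fun x => η (fun i => x (Fin.castLE h i)) * ∏ i : Fin N, if (i : ℕ) < k then 1 else θ (x i)

/-- `η` lies in the `k`-fold tensor power of the orthogonal complement of `θ`:
the contraction of `η` with `⟨θ|` at any slot vanishes. -/
def InPerpPow {J : Type*} [Fintype J] [DecidableEq J] {k : ℕ} (θ : J → ℂ)
    (η : (Fin k → J) → ℂ) : Prop :=
  ∀ (j : Fin k) (z : Fin k → J), ∑ a : J, star (θ a) * η (Function.update z j a) = 0

/-- Binary Shannon entropy. -/
def binEnt (x : ℝ) : ℝ := -(x * Real.logb 2 x) - (1 - x) * Real.logb 2 (1 - x)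

/-- Product operator `σ₁ ⊗ ⋯ ⊗ σ_k` of a `k`-partite system. -/
def prodOp {k : ℕ} {ι : Fin k → Type*} [∀ i, Fintype (ι i)]
    (σs : ∀ i, Matrix (ι i) (ι i) ℂ) : Matrix (∀ i, ι i) (∀ i, ι i) ℂ :=
  fun x y => ∏ i, σs i (x i) (y i)

/-- Separability of a `k`-partite state: a finite convex combination of product states. -/
def IsSeparable {k : ℕ} {ι : Fin k → Type*} [∀ i, Fintype (ι i)]
    (ρ : Matrix (∀ i, ι i) (∀ i, ι i) ℂ) : Prop :=
  ∃ (m : ℕ) (p : Fin m → ℝ) (σs : Fin m → ∀ i, Matrix (ι i) (ι i) ℂ),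
    (∀ j, 0 ≤ p j) ∧ (∑ j, p j = 1) ∧ (∀ j i, IsState (σs j i)) ∧
    ρ = ∑ j, p j • prodOp (σs j)

/-- Relative entropy of entanglement `E_R(ρ) = inf {S(ρ‖ω) : ω separable}`. -/
def ERel {k : ℕ} {ι : Fin k → Type*} [∀ i, Fintype (ι i)] [∀ i, DecidableEq (ι i)]
    (ρ : Matrix (∀ i, ι i) (∀ i, ι i) ℂ) : ℝ :=
  sInf {x | ∃ ω, IsSeparable ω ∧ SuppLe ρ ω ∧ x = relEnt ρ ω}

/-- `ρ^{⊗n}` of a `k`-partite state, viewed as a `k`-partite state where the `i`-th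
party holds the `n` copies of its system. -/
def tpowMulti {k : ℕ} {d : Fin k → ℕ} (ρ : Matrix (∀ i, Fin (d i)) (∀ i, Fin (d i)) ℂ)
    (n : ℕ) : Matrix (∀ i, Fin n → Fin (d i)) (∀ i, Fin n → Fin (d i)) ℂ :=
  fun x y => ∏ t : Fin n, ρ (fun i => x i t) (fun i => y i t)

/-- `ρ^{⊗n}` of a bipartite state in the grouped bipartition `A^{⊗n} : B^{⊗n}`. -/
def tpowBi {A B : Type*} [Fintype A] [Fintype B]
    (ρ : Matrix (A × B) (A × B) ℂ) (n : ℕ) :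
    Matrix ((Fin n → A) × (Fin n → B)) ((Fin n → A) × (Fin n → B)) ℂ :=
  fun x y => ∏ i, ρ (x.1 i, x.2 i) (y.1 i, y.2 i)

/-- `k`-extendibility of a bipartite state. -/
def IsKExtendible {A B : Type*} [Fintype A] [Fintype B] (k : ℕ)
    (σ : Matrix (A × B) (A × B) ℂ) : Prop :=
  ∃ σ' : Matrix (A × (Fin k → B)) (A × (Fin k → B)) ℂ,
    IsState σ' ∧
    (∀ (π : Equiv.Perm (Fin k)) (p q : A × (Fin k → B)),
      σ' (p.1, p.2 ∘ π) (q.1, q.2 ∘ π) = σ' p q) ∧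
    (∀ p q : A × B, σ p q =
      ∑ f : {i : Fin k // (i : ℕ) ≠ 0} → B,
        σ' (p.1, fun i => if h : (i : ℕ) = 0 then p.2 else f ⟨i, h⟩)
           (q.1, fun i => if h : (i : ℕ) = 0 then q.2 else f ⟨i, h⟩))

open Matrix

set_option linter.unusedSectionVars false

/-! ### Spectral decompositions -/

/-- The operator `U diag(a) U†`. -/
def diagConj (U : Matrix I I ℂ) (a : I → ℝ) : Matrix I I ℂ :=
  U * diagonal (fun i => (a i : ℂ)) * Uᴴ

/-- The outcome distribution of measuring `ρ` in the basis given by the columns of `U`. -/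
def weight (ρ U : Matrix I I ℂ) (i : I) : ℝ := ((Uᴴ * ρ * U) i i).re

lemma conjTranspose_mul_of_unitary {U : Matrix I I ℂ} (hU : U ∈ unitaryGroup I ℂ) :
    Uᴴ * U = 1 := by
  simpa [star_eq_conjTranspose] using mem_unitaryGroup_iff'.1 hU

lemma mul_conjTranspose_of_unitary {U : Matrix I I ℂ} (hU : U ∈ unitaryGroup I ℂ) :
    U * Uᴴ = 1 := by
  simpa [star_eq_conjTranspose] using mem_unitaryGroup_iff.1 hU

lemma fcal_eq_diagConj {A : Matrix I I ℂ} (hA : A.IsHermitian) (f : ℝ → ℝ) :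
    fcal f A = diagConj (hA.eigenvectorUnitary : Matrix I I ℂ) (fun i => f (hA.eigenvalues i)) := by
  simp [fcal, hA, diagConj, star_eq_conjTranspose]

lemma eq_diagConj {A : Matrix I I ℂ} (hA : A.IsHermitian) :
    A = diagConj (hA.eigenvectorUnitary : Matrix I I ℂ) hA.eigenvalues := by
  conv_lhs => rw [hA.spectral_theorem]
  rfl

lemma diagConj_isHermitian (U : Matrix I I ℂ) (a : I → ℝ) : (diagConj U a).IsHermitian := by
  unfold diagConj
  rw [IsHermitian, conjTranspose_mul, conjTranspose_mul, conjTranspose_conjTranspose,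
    diagonal_conjTranspose, Matrix.mul_assoc]
  congr 3
  ext i
  simp

lemma diagConj_mul {U : Matrix I I ℂ} (hU : U ∈ unitaryGroup I ℂ) (a b : I → ℝ) :
    diagConj U a * diagConj U b = diagConj U (fun i => a i * b i) := by
  unfold diagConj
  calc _ = U * diagonal (fun i => (a i : ℂ)) * (Uᴴ * U) * diagonal (fun i => (b i : ℂ)) * Uᴴ := by
        simp only [Matrix.mul_assoc]
    _ = _ := by
        rw [conjTranspose_mul_of_unitary hU, Matrix.mul_one, Matrix.mul_assoc U, diagonal_mul_diagonal]
        simp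

lemma diagConj_sub (U : Matrix I I ℂ) (a b : I → ℝ) :
    diagConj U a - diagConj U b = diagConj U (fun i => a i - b i) := by
  unfold diagConj
  rw [← Matrix.sub_mul, ← Matrix.mul_sub, diagonal_sub]
  simp

lemma smul_diagConj (U : Matrix I I ℂ) (c : ℝ) (a : I → ℝ) :
    c • diagConj U a = diagConj U (fun i => c * a i) := by
  unfold diagConj
  rw [← Matrix.smul_mul, ← Matrix.mul_smul, ← diagonal_smul]
  congr 3
  ext i
  simp

lemma diagConj_one {U : Matrix I I ℂ} (hU : U ∈ unitaryGroup I ℂ) :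
    diagConj U (fun _ => 1) = 1 := by
  simp [diagConj, mul_conjTranspose_of_unitary hU]

lemma diagConj_posSemidef (U : Matrix I I ℂ) {a : I → ℝ} (ha : ∀ i, 0 ≤ a i) :
    (diagConj U a).PosSemidef := by
  apply PosSemidef.mul_mul_conjTranspose_same
  rw [posSemidef_diagonal_iff]
  intro i
  exact_mod_cast ha i

lemma trace_diagConj_mul (U ρ : Matrix I I ℂ) (a : I → ℝ) :
    ((diagConj U a * ρ).trace).re = ∑ i, a i * weight ρ U i := by
  have : (diagConj U a * ρ).trace =
      (diagonal (fun i => (a i : ℂ)) * (Uᴴ * ρ * U)).trace := by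
    unfold diagConj
    rw [Matrix.mul_assoc, Matrix.mul_assoc, Matrix.trace_mul_comm]
    simp only [Matrix.mul_assoc]
  rw [this, trace]
  simp [diagonal_mul, weight, Complex.re_sum]

lemma weight_nonneg {ρ : Matrix I I ℂ} (hρ : ρ.PosSemidef) (U : Matrix I I ℂ) (i : I) :
    0 ≤ weight ρ U i := by
  have := (hρ.conjTranspose_mul_mul_same U).diag_nonneg (i := i)
  exact (Complex.le_def.1 this).1

lemma sum_weight {U : Matrix I I ℂ} (hU : U ∈ unitaryGroup I ℂ) (ρ : Matrix I I ℂ) :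
    ∑ i, weight ρ U i = (ρ.trace).re := by
  have := trace_diagConj_mul U ρ (fun _ => 1)
  rw [diagConj_one hU, Matrix.one_mul] at this
  simpa using this.symm

lemma weight_diagConj {U : Matrix I I ℂ} (hU : U ∈ unitaryGroup I ℂ) (a : I → ℝ) (i : I) :
    weight (diagConj U a) U i = a i := by
  have : Uᴴ * diagConj U a * U = diagonal (fun i => (a i : ℂ)) := by
    unfold diagConj
    calc _ = (Uᴴ * U) * diagonal (fun i => (a i : ℂ)) * (Uᴴ * U) := by
          simp only [Matrix.mul_assoc]
      _ = _ := by rw [conjTranspose_mul_of_unitary hU]; simp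
  simp [weight, this]

lemma fcal_diagConj {U : Matrix I I ℂ} (hU : U ∈ unitaryGroup I ℂ) (a : I → ℝ) (f : ℝ → ℝ) :
    fcal f (diagConj U a) = diagConj U (fun i => f (a i)) := by
  have hA := diagConj_isHermitian U a
  rw [fcal_eq_diagConj hA]
  set V : Matrix I I ℂ := (hA.eigenvectorUnitary : Matrix I I ℂ)
  have hVu : V ∈ unitaryGroup I ℂ := hA.eigenvectorUnitary.2
  have hAV : diagConj U a = diagConj V hA.eigenvalues := eq_diagConj hA
  set l := hA.eigenvalues
  have hW : diagonal (fun i => (a i : ℂ)) * (Uᴴ * V) = (Uᴴ * V) * diagonal (fun i => (l i : ℂ)) := by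
    calc _ = Uᴴ * U * diagonal (fun i => (a i : ℂ)) * Uᴴ * V := by
          rw [conjTranspose_mul_of_unitary hU]; simp [Matrix.mul_assoc]
      _ = Uᴴ * diagConj U a * V := by simp only [diagConj, Matrix.mul_assoc]
      _ = Uᴴ * V * diagonal (fun i => (l i : ℂ)) * (Vᴴ * V) := by
          rw [hAV]; simp only [diagConj, Matrix.mul_assoc]
      _ = _ := by rw [conjTranspose_mul_of_unitary hVu, Matrix.mul_one]
  have hWf : diagonal (fun i => (f (a i) : ℂ)) * (Uᴴ * V) =
      (Uᴴ * V) * diagonal (fun i => (f (l i) : ℂ)) := by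
    ext i j
    have := congrFun (congrFun hW i) j
    rw [diagonal_mul, mul_diagonal] at this ⊢
    by_cases h : (Uᴴ * V) i j = 0
    · simp [h]
    · rw [mul_comm] at this
      have h2 := mul_left_cancel₀ h this
      have h3 : a i = l j := by exact_mod_cast h2
      rw [h3, mul_comm]
  unfold diagConj
  calc _ = U * (Uᴴ * V * diagonal (fun i => (f (l i) : ℂ))) * Vᴴ := by
        rw [← Matrix.mul_assoc, ← Matrix.mul_assoc, mul_conjTranspose_of_unitary hU, Matrix.one_mul]
    _ = U * diagonal (fun i => (f (a i) : ℂ)) * Uᴴ * (V * Vᴴ) := by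
        rw [← hWf]; simp only [Matrix.mul_assoc]
    _ = _ := by rw [mul_conjTranspose_of_unitary hVu, Matrix.mul_one]

lemma le_of_diagConj_sub_smul_one {U : Matrix I I ℂ} (hU : U ∈ unitaryGroup I ℂ) {a : I → ℝ} {c : ℝ}
    (h : (diagConj U a - c • (1 : Matrix I I ℂ)).PosSemidef) (i : I) : c ≤ a i := by
  rw [← diagConj_one hU, smul_diagConj, diagConj_sub] at h
  have := weight_nonneg h U i
  rw [weight_diagConj hU] at this
  linarith

/-! ### Traces against positive semidefinite operators -/

lemma re_trace_mul_nonneg {A B : Matrix I I ℂ} (hA : A.PosSemidef) (hB : B.PosSemidef) :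
    0 ≤ ((A * B).trace).re := by
  rw [eq_diagConj hA.1, trace_diagConj_mul]
  exact Finset.sum_nonneg fun i _ => mul_nonneg (hA.eigenvalues_nonneg i) (weight_nonneg hB _ i)

lemma re_trace_mul_le {A B ρ : Matrix I I ℂ} (h : (B - A).PosSemidef) (hρ : ρ.PosSemidef) :
    ((A * ρ).trace).re ≤ ((B * ρ).trace).re := by
  have := re_trace_mul_nonneg h hρ
  rw [Matrix.sub_mul, trace_sub, Complex.sub_re] at this
  linarith

lemma exists_eq_diagConj {A : Matrix I I ℂ} (hA : A.PosSemidef) :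
    ∃ U ∈ unitaryGroup I ℂ, ∃ a : I → ℝ, (∀ i, 0 ≤ a i) ∧ A = diagConj U a :=
  ⟨_, hA.1.eigenvectorUnitary.2, _, hA.eigenvalues_nonneg, eq_diagConj hA.1⟩

lemma sum_eq_re_trace_diagConj {U : Matrix I I ℂ} (hU : U ∈ unitaryGroup I ℂ) (a : I → ℝ) :
    ∑ i, a i = ((diagConj U a).trace).re := by
  rw [← sum_weight hU]
  simp only [weight_diagConj hU]

lemma IsState.diagConj_le_one {U : Matrix I I ℂ} (hU : U ∈ unitaryGroup I ℂ) {a : I → ℝ}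
    (ha : ∀ i, 0 ≤ a i) (h : IsState (diagConj U a)) (i : I) : a i ≤ 1 := by
  have hsum := sum_eq_re_trace_diagConj hU a
  rw [h.2, Complex.one_re] at hsum
  rw [← hsum]
  exact Finset.single_le_sum (f := a) (fun j _ => ha j) (Finset.mem_univ i)

lemma IsState.one_sub_posSemidef {ρ : Matrix I I ℂ} (hρ : IsState ρ) : (1 - ρ).PosSemidef := by
  obtain ⟨U, hU, a, ha, rfl⟩ := exists_eq_diagConj hρ.1
  rw [← diagConj_one hU, diagConj_sub]
  exact diagConj_posSemidef _ fun i => sub_nonneg.2 (hρ.diagConj_le_one hU ha i)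

/-- The expectation value `A ↦ Re tr(A ρ)` as a real linear functional. -/
def expect (ρ : Matrix I I ℂ) : Matrix I I ℂ →ₗ[ℝ] ℝ where
  toFun A := ((A * ρ).trace).re
  map_add' A B := by simp [Matrix.add_mul]
  map_smul' c A := by simp

lemma expect_apply (ρ A : Matrix I I ℂ) : expect ρ A = ((A * ρ).trace).re := rfl

lemma expect_nonneg {ρ A : Matrix I I ℂ} (hA : A.PosSemidef) (hρ : ρ.PosSemidef) :
    0 ≤ expect ρ A := re_trace_mul_nonneg hA hρ

lemma expect_le {ρ A B : Matrix I I ℂ} (h : (B - A).PosSemidef) (hρ : ρ.PosSemidef) :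
    expect ρ A ≤ expect ρ B := re_trace_mul_le h hρ

lemma expect_one {ρ : Matrix I I ℂ} (hρ : IsState ρ) : expect ρ 1 = 1 := by
  simp [expect_apply, hρ.2]

lemma expect_diagConj (ρ U : Matrix I I ℂ) (a : I → ℝ) :
    expect ρ (diagConj U a) = ∑ i, a i * weight ρ U i := trace_diagConj_mul U ρ a

lemma posSemidef_of_isHermitian_of_mul_self {P : Matrix I I ℂ} (h : P.IsHermitian)
    (h2 : P * P = P) : P.PosSemidef := by
  have := posSemidef_conjTranspose_mul_self P
  rwa [h.eq, h2] at this

lemma isHermitian_one_sub {P : Matrix I I ℂ} (h : P.IsHermitian) : (1 - P).IsHermitian :=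
  isHermitian_one.sub h

lemma one_sub_mul_self {P : Matrix I I ℂ} (h2 : P * P = P) : (1 - P) * (1 - P) = 1 - P := by
  rw [Matrix.sub_mul, Matrix.one_mul, Matrix.mul_sub, h2]; simp

lemma PosSemidef.smul_real {A : Matrix I I ℂ} (hA : A.PosSemidef) {c : ℝ} (hc : 0 ≤ c) :
    (c • A).PosSemidef := hA.smul hc

lemma PosSemidef.sandwich {A B : Matrix I I ℂ} (hA : A.PosSemidef) (hB : B.IsHermitian) :
    (B * A * B).PosSemidef := by
  simpa [hB.eq] using hA.mul_mul_conjTranspose_same B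

lemma expect_compress_le {ρ T P : Matrix I I ℂ} (hρ : ρ.PosSemidef) (hT : (1 - T).PosSemidef)
    (hP : P.IsHermitian) (hPP : P * P = P) : expect ρ (P * T * P) ≤ expect ρ P := by
  refine expect_le ?_ hρ
  have := PosSemidef.sandwich hT hP
  rwa [Matrix.mul_sub, Matrix.mul_one, Matrix.sub_mul, hPP] at this

/-- If `T` projects onto small eigenvalues of `σ` while `R` projects onto large eigenvalues of
`τ ≤ 3σ`, then `T` has small probability on any state on which `R` is likely. -/
lemma expect_le_of_large_eigenvalues {ρ σ τ T R : Matrix I I ℂ} (hρ : IsState ρ)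
    (hT : T.IsHermitian) (hTT : T * T = T) (hR : R.IsHermitian) (hRR : R * R = R)
    {β θ : ℝ} (hβ : 0 < β) (hθ : 0 < θ)
    (hτ : (τ - β • R).PosSemidef) (hστ : ((3 : ℝ) • σ - τ).PosSemidef)
    (hσ : (θ • T - T * σ * T).PosSemidef) :
    expect ρ T ≤ 2 * (3 * θ / β) + 2 * expect ρ (1 - R) := by
  set c := 3 * θ / β with hc
  have hcpos : 0 < c := by positivity
  have h1 : (c • T - T * R * T).PosSemidef := by
    have e : c • T - T * R * T = (3 / β) • (θ • T - T * σ * T) +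
        (1 / β) • (T * ((3 : ℝ) • σ - τ) * T) + (1 / β) • (T * (τ - β • R) * T) := by
      simp only [Matrix.mul_sub, Matrix.sub_mul, Matrix.mul_smul, Matrix.smul_mul, smul_sub,
        smul_smul, hc]
      rw [show 1 / β * β = 1 by field_simp, show 3 / β * θ = 3 * θ / β by ring,
        show 1 / β * 3 = 3 / β by ring, one_smul]
      abel
    rw [e]
    exact (PosSemidef.add (PosSemidef.add (PosSemidef.smul_real hσ (by positivity))
      (PosSemidef.smul_real (PosSemidef.sandwich hστ hT) (by positivity)))
      (PosSemidef.smul_real (PosSemidef.sandwich hτ hT) (by positivity)))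
  have hTp := posSemidef_of_isHermitian_of_mul_self hT hTT
  have h1T := posSemidef_of_isHermitian_of_mul_self (isHermitian_one_sub hT) (one_sub_mul_self hTT)
  have hX : (R * T * R).IsHermitian := (PosSemidef.sandwich hTp hR).1
  have h2 : (c ^ 2 • (1 : Matrix I I ℂ) - c • (R * T * R)).PosSemidef := by
    have e : c ^ 2 • (1 : Matrix I I ℂ) - c • (R * T * R) =
        (R * T * R - c • 1) * 1 * (R * T * R - c • 1) + R * (c • T - T * R * T) * R := by
      have e2 : R * T * R * (R * T * R) = R * (T * R * T) * R := by
        calc _ = R * T * (R * R) * T * R := by simp only [Matrix.mul_assoc]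
          _ = _ := by rw [hRR]; simp only [Matrix.mul_assoc]
      simp only [Matrix.mul_sub, Matrix.sub_mul, Matrix.mul_smul, Matrix.smul_mul, Matrix.mul_one,
        Matrix.one_mul, e2, smul_smul, sq, smul_sub]
      abel
    rw [e]
    refine PosSemidef.add (PosSemidef.sandwich PosSemidef.one ?_) (PosSemidef.sandwich h1 hR)
    exact hX.sub (PosSemidef.smul_real PosSemidef.one hcpos.le).1
  have h3 : expect ρ (R * T * R) ≤ c := by
    have := expect_nonneg h2 hρ.1
    rw [map_sub, map_smul, map_smul, expect_one hρ, smul_eq_mul, smul_eq_mul] at this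
    nlinarith
  have h4 : expect ρ ((1 - R) * T * (1 - R)) ≤ expect ρ (1 - R) :=
    expect_compress_le hρ.1 h1T (isHermitian_one_sub hR) (one_sub_mul_self hRR)
  have h5 : expect ρ T ≤ expect ρ ((2 : ℝ) • (R * T * R) + (2 : ℝ) • ((1 - R) * T * (1 - R))) := by
    refine expect_le ?_ hρ.1
    have := PosSemidef.sandwich hTp ((PosSemidef.smul_real
      (posSemidef_of_isHermitian_of_mul_self hR hRR) (zero_le_two (α := ℝ))).1.sub isHermitian_one)
    convert this using 1
    simp only [two_smul]
    noncomm_ring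
  rw [map_add, map_smul, map_smul, smul_eq_mul, smul_eq_mul] at h5
  linarith

/-- If no test distinguishes `ρ` from `ω ≤ 3σ` well, then the projection `T` onto small eigenvalues
of `σ` cannot have probability close to one on `ρ`; here `Q` is a typical projection for `ρ`. -/
lemma expect_le_of_indistinguishable {ρ σ ω T Q : Matrix I I ℂ} (hρ : IsState ρ)
    (hT : T.IsHermitian) (hTT : T * T = T) (hQ : Q.IsHermitian) (hQQ : Q * Q = Q)
    (hQρ : Q * ρ = ρ * Q) {θ l η : ℝ} (hθ : 0 < θ) (hl : 0 ≤ l)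
    (hσω : ((3 : ℝ) • σ - ω).PosSemidef) (hσ : (θ • T - T * σ * T).PosSemidef)
    (htest : ∀ A : Matrix I I ℂ, A.PosSemidef → (1 - A).PosSemidef →
      expect ρ A - l * expect ω A ≤ 1 - η) :
    expect ρ T ≤ 1 - η / 2 + 3 / 2 * (l * θ * (Q.trace).re) + expect ρ (1 - Q) := by
  have hQp := posSemidef_of_isHermitian_of_mul_self hQ hQQ
  have hTp := posSemidef_of_isHermitian_of_mul_self hT hTT
  have h1T := posSemidef_of_isHermitian_of_mul_self (isHermitian_one_sub hT) (one_sub_mul_self hTT)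
  have h1Q := posSemidef_of_isHermitian_of_mul_self (isHermitian_one_sub hQ) (one_sub_mul_self hQQ)
  have hA : (T * Q * T).PosSemidef := PosSemidef.sandwich hQp hT
  have hA1 : (1 - T * Q * T).PosSemidef := by
    have e : 1 - T * Q * T = (1 - T) + T * (1 - Q) * T := by
      rw [Matrix.mul_sub, Matrix.sub_mul, Matrix.mul_one, hTT]; abel
    rw [e]
    exact h1T.add (PosSemidef.sandwich h1Q hT)
  have ht := htest _ hA hA1
  have h1 : expect ω (T * Q * T) ≤ 3 * θ * (Q.trace).re := by
    have a1 : expect ω (T * Q * T) ≤ expect ((3 : ℝ) • σ) (T * Q * T) := by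
      have := re_trace_mul_nonneg hA hσω
      rw [Matrix.mul_sub, trace_sub, Complex.sub_re] at this
      simp only [expect_apply]
      linarith
    have a2 : expect ((3 : ℝ) • σ) (T * Q * T) = 3 * ((T * σ * T * Q).trace).re := by
      rw [expect_apply, Matrix.mul_smul, trace_smul, Matrix.trace_mul_comm]
      have : (σ * (T * Q * T)).trace = (T * σ * T * Q).trace := by
        rw [← Matrix.mul_assoc, Matrix.trace_mul_comm]
        simp only [Matrix.mul_assoc]
      rw [this]
      simp
    have a3 : ((T * σ * T * Q).trace).re ≤ ((θ • T * Q).trace).re := re_trace_mul_le hσ hQp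
    have a4 : ((T * Q).trace).re ≤ (((1 : Matrix I I ℂ) * Q).trace).re := re_trace_mul_le h1T hQp
    rw [Matrix.one_mul] at a4
    have a5 : ((θ • T * Q).trace).re = θ * ((T * Q).trace).re := by
      rw [Matrix.smul_mul, trace_smul]; simp
    nlinarith
  have h2 : 0 ≤ 1 - 2 * expect ρ (Q * T) + expect ρ (T * Q * T) := by
    have hp := posSemidef_conjTranspose_mul_self (1 - Q * T)
    have e : (1 - Q * T)ᴴ * (1 - Q * T) = 1 - T * Q - Q * T + T * Q * T := by
      rw [conjTranspose_sub, conjTranspose_mul, hT.eq, hQ.eq, conjTranspose_one]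
      have : T * Q * (Q * T) = T * Q * T := by
        rw [← Matrix.mul_assoc, Matrix.mul_assoc T Q Q, hQQ]
      rw [Matrix.sub_mul, Matrix.mul_sub, Matrix.mul_sub, this]
      simp only [Matrix.one_mul, Matrix.mul_one]
      abel
    rw [e] at hp
    have := expect_nonneg hp hρ.1
    rw [map_add, map_sub, map_sub, expect_one hρ] at this
    have e2 : expect ρ (T * Q) = expect ρ (Q * T) := by
      have : T * Q * ρ = (ρ * (Q * T))ᴴ := by
        simp only [conjTranspose_mul, hT.eq, hQ.eq, hρ.1.1.eq]
      rw [expect_apply, expect_apply, this, trace_conjTranspose, Matrix.trace_mul_comm]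
      simp
    linarith
  have h3 : expect ρ T - expect ρ (1 - Q) ≤ expect ρ (Q * T) := by
    have e : expect ρ T - expect ρ (Q * T) = expect ρ ((1 - Q) * T * (1 - Q)) := by
      rw [← map_sub, show T - Q * T = (1 - Q) * T by rw [Matrix.sub_mul, Matrix.one_mul]]
      have : (1 - Q) * ρ = ρ * (1 - Q) := by
        rw [Matrix.sub_mul, Matrix.mul_sub, hQρ]; simp
      simp only [expect_apply]
      rw [Matrix.mul_assoc _ (1 - Q) ρ, this, ← Matrix.mul_assoc, Matrix.trace_mul_comm _ (1 - Q),
        ← Matrix.mul_assoc, ← Matrix.mul_assoc, one_sub_mul_self hQQ]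
    have h4 : expect ρ ((1 - Q) * T * (1 - Q)) ≤ expect ρ (1 - Q) :=
      expect_compress_le hρ.1 h1T (isHermitian_one_sub hQ) (one_sub_mul_self hQQ)
    linarith
  have h5 := mul_le_mul_of_nonneg_left h1 hl
  nlinarith

/-- Bounding the mean of a random variable through two of its tails. -/
lemma sum_mul_le_of_tails {w f : I → ℝ} (hw : ∀ i, 0 ≤ w i) (hsum : ∑ i, w i = 1) {a b c : ℝ}
    (hab : a ≤ b) (hf : ∀ i, f i ≤ c) :
    ∑ i, f i * w i ≤ a + (b - a) * (∑ i, (if a ≤ f i then 1 else 0) * w i) +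
      (c - b) * (∑ i, (if b ≤ f i then 1 else 0) * w i) := by
  have : a + (b - a) * (∑ i, (if a ≤ f i then 1 else 0) * w i) +
      (c - b) * (∑ i, (if b ≤ f i then 1 else 0) * w i) =
      ∑ i, (a + (b - a) * (if a ≤ f i then 1 else 0) + (c - b) * (if b ≤ f i then 1 else 0)) * w i := by
    simp only [add_mul, Finset.sum_add_distrib, ← Finset.mul_sum, mul_assoc, hsum, mul_one]
  rw [this]
  refine Finset.sum_le_sum fun i _ => mul_le_mul_of_nonneg_right ?_ (hw i)
  have := hf i
  split_ifs <;> linarith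

/-! ### Tensor powers -/

lemma tpow_mul (A B : Matrix I I ℂ) (n : ℕ) : tpow A n * tpow B n = tpow (A * B) n := by
  ext x y
  simp only [tpow, Matrix.mul_apply, ← Finset.prod_mul_distrib]
  rw [Finset.prod_univ_sum, Fintype.piFinset_univ]

lemma tpow_conjTranspose (A : Matrix I I ℂ) (n : ℕ) : (tpow A n)ᴴ = tpow Aᴴ n := by
  ext x y
  simp [tpow, conjTranspose_apply]

lemma tpow_diagonal (a : I → ℂ) (n : ℕ) :
    tpow (diagonal a) n = diagonal (fun x : Fin n → I => ∏ i, a (x i)) := by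
  ext x y
  by_cases h : x = y
  · subst h; simp [tpow]
  · rw [diagonal_apply_ne _ h]
    obtain ⟨i, hi⟩ := Function.ne_iff.1 h
    exact Finset.prod_eq_zero (Finset.mem_univ i) (diagonal_apply_ne _ hi)

lemma tpow_one (n : ℕ) : tpow (1 : Matrix I I ℂ) n = 1 := by
  rw [← diagonal_one, tpow_diagonal]
  simp

lemma tpow_mem_unitaryGroup {U : Matrix I I ℂ} (hU : U ∈ unitaryGroup I ℂ) (n : ℕ) :
    tpow U n ∈ unitaryGroup (Fin n → I) ℂ := by
  rw [mem_unitaryGroup_iff, star_eq_conjTranspose, tpow_conjTranspose, tpow_mul,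
    mul_conjTranspose_of_unitary hU, tpow_one]

lemma tpow_diagConj (U : Matrix I I ℂ) (a : I → ℝ) (n : ℕ) :
    tpow (diagConj U a) n = diagConj (tpow U n) (fun x => ∏ i, a (x i)) := by
  unfold diagConj
  rw [← tpow_mul, ← tpow_mul, tpow_diagonal, tpow_conjTranspose]
  simp

lemma trace_tpow (A : Matrix I I ℂ) (n : ℕ) : (tpow A n).trace = A.trace ^ n := by
  exact (Fintype.sum_pow (fun i => A i i) n).symm

lemma IsState.tpow {ρ : Matrix I I ℂ} (hρ : IsState ρ) (n : ℕ) : IsState (tpow ρ n) := by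
  refine ⟨?_, by rw [trace_tpow, hρ.2, one_pow]⟩
  obtain ⟨U, hU, a, ha, rfl⟩ := exists_eq_diagConj hρ.1
  rw [tpow_diagConj]
  exact diagConj_posSemidef _ fun x => Finset.prod_nonneg fun i _ => ha _

lemma weight_tpow {ρ : Matrix I I ℂ} (hρ : ρ.IsHermitian) (U : Matrix I I ℂ) (n : ℕ)
    (x : Fin n → I) : weight (tpow ρ n) (tpow U n) x = ∏ i, weight ρ U (x i) := by
  have hre : ∀ i, (Uᴴ * ρ * U) i i = ((weight ρ U i : ℝ) : ℂ) := fun i =>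
    ((isHermitian_conjTranspose_mul_mul U hρ).coe_re_apply_self i).symm
  rw [weight, tpow_conjTranspose, tpow_mul, tpow_mul]
  simp only [GQSL.tpow, hre]
  rw [← Complex.ofReal_prod, Complex.ofReal_re]

/-! ### The weak law of large numbers on a finite probability space -/

lemma exists_sum_mul_exp_lt_one {w c : I → ℝ} (hw : ∑ i, w i = 1) (hc : ∑ i, w i * c i < 0) :
    ∃ s > 0, ∑ i, w i * Real.exp (s * c i) < 1 := by
  have hd : HasDerivAt (fun s : ℝ => ∑ i, w i * Real.exp (s * c i)) (∑ i, w i * c i) 0 := by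
    refine HasDerivAt.fun_sum fun i _ => ?_
    have : HasDerivAt (fun s : ℝ => Real.exp (s * c i)) (Real.exp (0 * c i) * (1 * c i)) 0 :=
      ((hasDerivAt_id (0 : ℝ)).mul_const (c i)).exp
    simpa using this.const_mul (w i)
  have h := hd.tendsto_slope_zero_right.eventually_lt_const hc
  obtain ⟨s, hs, hs0⟩ := (h.and self_mem_nhdsWithin).exists
  refine ⟨s, hs0, ?_⟩
  have hs0 : 0 < s := hs0
  simp only [zero_add, zero_mul, Real.exp_zero, mul_one, hw, smul_eq_mul] at hs
  have := (mul_neg_iff.1 hs)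
  rcases this with h | h
  · linarith [h.2]
  · linarith [inv_pos.2 hs0, h.1]

lemma tendsto_upper_tail {w f : I → ℝ} (hw0 : ∀ i, 0 ≤ w i) (hw : ∑ i, w i = 1) {δ : ℝ}
    (hδ : 0 < δ) :
    Tendsto (fun k : ℕ => ∑ x : Fin k → I,
      if k * (∑ i, f i * w i + δ) < ∑ i, f (x i) then ∏ i, w (x i) else 0) atTop (nhds 0) := by
  set μ := ∑ i, f i * w i with hμ
  obtain ⟨s, hs, hr⟩ := exists_sum_mul_exp_lt_one (w := w) (c := fun i => f i - μ - δ) hw (by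
    simp only [mul_sub, Finset.sum_sub_distrib, ← Finset.sum_mul, hw]
    have : ∑ i, w i * f i = μ := by simp [hμ, mul_comm]
    rw [this]; linarith)
  set r := ∑ i, w i * Real.exp (s * (f i - μ - δ)) with hrdef
  have hr0 : 0 ≤ r := Finset.sum_nonneg fun i _ => mul_nonneg (hw0 i) (Real.exp_pos _).le
  refine squeeze_zero (fun k => ?_) (fun k => ?_) (tendsto_pow_atTop_nhds_zero_of_lt_one hr0 hr)
  · refine Finset.sum_nonneg fun x _ => ?_
    split_ifs
    · exact Finset.prod_nonneg fun i _ => hw0 _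
    · rfl
  · have : r ^ k = ∑ x : Fin k → I, ∏ i, (w (x i) * Real.exp (s * (f (x i) - μ - δ))) := by
      rw [hrdef, Fintype.sum_pow]
    rw [this]
    refine Finset.sum_le_sum fun x _ => ?_
    have hp : 0 ≤ ∏ i, w (x i) := Finset.prod_nonneg fun i _ => hw0 _
    rw [Finset.prod_mul_distrib, ← Real.exp_sum]
    split_ifs with h
    · refine le_mul_of_one_le_right hp (Real.one_le_exp ?_)
      rw [← Finset.mul_sum]
      refine mul_nonneg hs.le ?_
      simp only [Finset.sum_sub_distrib, Finset.sum_const, Finset.card_univ, Fintype.card_fin,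
        nsmul_eq_mul]
      linarith
    · exact mul_nonneg hp (Real.exp_pos _).le

lemma weight_eq_zero {ρ U : Matrix I I ℂ} (hU : U ∈ unitaryGroup I ℂ) {a : I → ℝ}
    (hs : SuppLe ρ (diagConj U a)) {i : I} (hi : a i = 0) : weight ρ U i = 0 := by
  have hcol : diagConj U a * U = U * diagonal (fun i => (a i : ℂ)) := by
    unfold diagConj
    rw [Matrix.mul_assoc, conjTranspose_mul_of_unitary hU, Matrix.mul_one]
  have h0 : (diagConj U a).mulVec (U.mulVec (Pi.single i 1)) = 0 := by
    rw [mulVec_mulVec, hcol]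
    ext j
    simp [mul_diagonal, hi]
  have h1 := hs _ h0
  have h2 : (Uᴴ * ρ * U).mulVec (Pi.single i 1) = 0 := by
    rw [← mulVec_mulVec, ← mulVec_mulVec, h1, mulVec_zero]
  have h3 := congrFun h2 i
  simp only [mulVec_single_one, Matrix.col_apply, Pi.zero_apply] at h3
  simp [weight, h3]

lemma trace_mul_mlog_diagConj {U : Matrix I I ℂ} (hU : U ∈ unitaryGroup I ℂ) (ρ : Matrix I I ℂ)
    (a : I → ℝ) : ((ρ * mlog (diagConj U a)).trace).re =
      ∑ i, (if 0 < a i then Real.logb 2 (a i) else 0) * weight ρ U i := by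
  rw [Matrix.trace_mul_comm, mlog, fcal_diagConj hU, trace_diagConj_mul]

/-- Typical projections: on all but a vanishing part of `ρ^{⊗k}`, the operator `τ^{⊗k}` has
eigenvalues at least `2^(-k(b + δ))`, with `b = -tr(ρ log τ)`. -/
lemma exists_typical_projection {ρ τ : Matrix I I ℂ} (hρ : IsState ρ) (hτ : τ.PosSemidef)
    (hs : SuppLe ρ τ) {δ : ℝ} (hδ : 0 < δ) :
    ∃ R : ∀ k : ℕ, Matrix (Fin k → I) (Fin k → I) ℂ,
      (∀ k, (R k).IsHermitian ∧ R k * R k = R k ∧ R k * tpow τ k = tpow τ k * R k ∧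
        (tpow τ k - ((2 : ℝ) ^ (-(k * (-((ρ * mlog τ).trace).re + δ)))) • R k).PosSemidef) ∧
      Tendsto (fun k => expect (tpow ρ k) (1 - R k)) atTop (nhds 0) := by
  obtain ⟨U, hU, t, ht, rfl⟩ := exists_eq_diagConj hτ
  set f : I → ℝ := fun i => -(if 0 < t i then Real.logb 2 (t i) else 0) with hf
  set w := weight ρ U with hw
  have hw0 : ∀ i, 0 ≤ w i := weight_nonneg hρ.1 U
  have hw1 : ∑ i, w i = 1 := by rw [hw, sum_weight hU, hρ.2, Complex.one_re]
  have hb : -((ρ * mlog (diagConj U t)).trace).re = ∑ i, f i * w i := by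
    rw [trace_mul_mlog_diagConj hU]
    simp [hf, hw]
  rw [hb]
  set b := ∑ i, f i * w i
  set g : ∀ k : ℕ, (Fin k → I) → ℝ := fun k x =>
    if (2 : ℝ) ^ (-(k * (b + δ))) ≤ ∏ i, t (x i) then 1 else 0 with hg
  refine ⟨fun k => diagConj (tpow U k) (g k), fun k => ⟨diagConj_isHermitian _ _, ?_, ?_, ?_⟩, ?_⟩
  · rw [diagConj_mul (tpow_mem_unitaryGroup hU k)]
    congr 1
    ext x
    simp [hg]
  · rw [tpow_diagConj, diagConj_mul (tpow_mem_unitaryGroup hU k),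
      diagConj_mul (tpow_mem_unitaryGroup hU k)]
    congr 1
    ext x
    ring
  · rw [tpow_diagConj, smul_diagConj, diagConj_sub]
    refine diagConj_posSemidef _ fun x => ?_
    simp only [hg]
    split_ifs with h
    · linarith
    · simpa using Finset.prod_nonneg fun i _ => ht (x i)
  · refine squeeze_zero (fun k => ?_) (fun k => ?_) (tendsto_upper_tail (f := f) hw0 hw1 hδ)
    all_goals
      rw [← diagConj_one (tpow_mem_unitaryGroup hU k), diagConj_sub, expect_diagConj]
      simp only [weight_tpow hρ.1.1]
    · refine Finset.sum_nonneg fun x _ =>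
        mul_nonneg ?_ (Finset.prod_nonneg fun i _ => hw0 _)
      simp only [hg]
      split_ifs <;> norm_num
    · refine Finset.sum_le_sum fun x _ => ?_
      have hp : 0 ≤ ∏ i, w (x i) := Finset.prod_nonneg fun i _ => hw0 _
      by_cases hz : ∏ i, w (x i) = 0
      · simp [← hw, hz]
      have htpos : ∀ i, 0 < t (x i) := fun i => by
        refine lt_of_le_of_ne (ht _) fun h => hz ?_
        exact Finset.prod_eq_zero (Finset.mem_univ i) (weight_eq_zero hU hs h.symm)
      simp only [hg]
      by_cases hx : (2 : ℝ) ^ (-(k * (b + δ))) ≤ ∏ i, t (x i)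
      · rw [if_pos hx, sub_self, zero_mul]
        split_ifs
        · exact hp
        · rfl
      · rw [if_neg hx, sub_zero, one_mul, if_pos]
        have hlog := Real.logb_lt_logb (b := 2) (by norm_num)
          (Finset.prod_pos fun i _ => htpos i) (not_le.1 hx)
        rw [Real.logb_rpow (by norm_num) (by norm_num), Real.logb_prod _ _ fun i _ => (htpos i).ne'] at hlog
        have : ∑ i, f (x i) = -∑ i, Real.logb 2 (t (x i)) := by
          simp [hf, htpos]
        rw [this]
        linarith

/-! ### Tests and the minimax theorem -/

/-- The set of tests (effects) `0 ≤ A ≤ 1`. -/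
def tests (I : Type*) [Fintype I] [DecidableEq I] : Set (Matrix I I ℂ) :=
  {A | A.PosSemidef ∧ (1 - A).PosSemidef}

lemma isClosed_posSemidef : IsClosed {A : Matrix I I ℂ | A.PosSemidef} := by
  simp only [posSemidef_iff_dotProduct_mulVec, Set.ofPred_and, Set.ofPred_forall]
  refine IsClosed.inter (isClosed_eq (by fun_prop) continuous_id)
    (isClosed_iInter fun x => isClosed_le continuous_const ?_)
  fun_prop

lemma isClosed_tests : IsClosed (tests I) :=
  isClosed_posSemidef.inter (isClosed_posSemidef.preimage (continuous_const.sub continuous_id))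

lemma norm_apply_le_of_mem_tests {A : Matrix I I ℂ} (hA : A ∈ tests I) (i j : I) :
    ‖A i j‖ ≤ Fintype.card I := by
  obtain ⟨h0, h1⟩ := hA
  obtain ⟨U, hU, a, ha, rfl⟩ := exists_eq_diagConj h0
  have ha1 : ∀ k, a k ≤ 1 := fun k => by
    rw [← diagConj_one hU, diagConj_sub] at h1
    have := weight_nonneg h1 U k
    rw [weight_diagConj hU] at this
    linarith
  unfold diagConj
  rw [Matrix.mul_apply]
  refine (norm_sum_le _ _).trans ?_
  have : ∀ k ∈ Finset.univ, ‖(U * diagonal fun i => (a i : ℂ)) i k * Uᴴ k j‖ ≤ 1 := fun k _ => by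
    rw [mul_diagonal, norm_mul, norm_mul, conjTranspose_apply, norm_star, Complex.norm_real,
      Real.norm_of_nonneg (ha k)]
    have b1 := entry_norm_bound_of_unitary hU i k
    have b2 := entry_norm_bound_of_unitary hU j k
    exact mul_le_one₀ (mul_le_one₀ b1 (ha k) (ha1 k)) (norm_nonneg _) b2
  simpa using Finset.sum_le_sum this

lemma isCompact_tests : IsCompact (tests I) := by
  have hK : IsCompact (Set.pi Set.univ fun _ : I => Set.pi Set.univ fun _ : I =>
      Metric.closedBall (0 : ℂ) (Fintype.card I)) :=
    isCompact_univ_pi fun _ => isCompact_univ_pi fun _ => isCompact_closedBall _ _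
  refine IsCompact.of_isClosed_subset hK isClosed_tests fun A hA => ?_
  intro i _ j _
  simpa using norm_apply_le_of_mem_tests hA i j

lemma convex_tests : Convex ℝ (tests I) := by
  intro A hA B hB a b ha hb hab
  refine ⟨(PosSemidef.smul_real hA.1 ha).add (PosSemidef.smul_real hB.1 hb), ?_⟩
  have : 1 - (a • A + b • B) = a • (1 - A) + b • (1 - B) := by
    rw [smul_sub, smul_sub]
    have : (1 : Matrix I I ℂ) = a • 1 + b • 1 := by rw [← add_smul, hab, one_smul]
    nth_rewrite 1 [this]
    abel
  rw [this]
  exact (PosSemidef.smul_real hA.2 ha).add (PosSemidef.smul_real hB.2 hb)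

lemma zero_mem_tests : (0 : Matrix I I ℂ) ∈ tests I := ⟨PosSemidef.zero, by simpa using PosSemidef.one⟩

lemma one_mem_tests : (1 : Matrix I I ℂ) ∈ tests I := ⟨PosSemidef.one, by simpa using PosSemidef.zero⟩

lemma expect_add_left (ρ ω A : Matrix I I ℂ) : expect (ρ + ω) A = expect ρ A + expect ω A := by
  simp [expect_apply, Matrix.mul_add]

lemma expect_smul_left (c : ℝ) (ρ A : Matrix I I ℂ) : expect (c • ρ) A = c * expect ρ A := by
  simp [expect_apply]

lemma continuous_expect (ρ : Matrix I I ℂ) : Continuous (expect ρ) := by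
  unfold expect
  simp only [LinearMap.coe_mk, AddHom.coe_mk]
  fun_prop

lemma continuous_expect_left (A : Matrix I I ℂ) : Continuous fun ρ => expect ρ A := by
  simp only [expect_apply]
  fun_prop

/-- Either some test distinguishes `ρ` from all of `S` simultaneously, or some element of `S` is
indistinguishable from `ρ`. -/
lemma exists_test_or_exists_indistinguishable {S : Set (Matrix I I ℂ)} (hS : Convex ℝ S)
    (hSc : IsClosed S) (hne : S.Nonempty) (hst : ∀ ω ∈ S, IsState ω) (ρ : Matrix I I ℂ) (l v : ℝ) :
    (∃ A ∈ tests I, ∀ ω ∈ S, v ≤ expect ρ A - l * expect ω A) ∨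
      ∃ ω ∈ S, ∀ A ∈ tests I, expect ρ A - l * expect ω A ≤ v := by
  have hSk : IsCompact S := isCompact_tests.of_isClosed_subset hSc fun ω hω =>
    ⟨(hst ω hω).1, (hst ω hω).one_sub_posSemidef⟩
  obtain ⟨ω, hω, A, hA, h⟩ := Sion.exists_isSaddlePointOn (X := S) (Y := tests I)
    (f := fun ω A => expect ρ A - l * expect ω A) hne hS hSk
    (fun A _ => (continuous_const.sub
      (continuous_const.mul (continuous_expect_left A))).lowerSemicontinuous.lowerSemicontinuousOn _)
    (fun A _ => by
      refine ConvexOn.quasiconvexOn ⟨hS, fun x _ y _ a b _ _ hab => le_of_eq ?_⟩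
      simp only [expect_add_left, expect_smul_left, smul_eq_mul]
      linear_combination -(expect ρ A) * hab)
    convex_tests ⟨0, zero_mem_tests⟩ isCompact_tests
    (fun ω _ => ((continuous_expect ρ).sub
      (continuous_const.mul (continuous_expect ω))).upperSemicontinuous.upperSemicontinuousOn _)
    (fun ω _ => by
      refine ConcaveOn.quasiconcaveOn ⟨convex_tests, fun x _ y _ a b _ _ hab => le_of_eq ?_⟩
      simp only [map_add, map_smul, smul_eq_mul]
      ring)
  by_cases hv : ∀ ω ∈ S, v ≤ expect ρ A - l * expect ω A
  · exact Or.inl ⟨A, hA, hv⟩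
  · push Not at hv
    obtain ⟨ω', hω', hlt⟩ := hv
    exact Or.inr ⟨ω, hω, fun B hB => (h ω' hω' B hB).trans hlt.le⟩

/-! ### Extending tests by an identity factor -/

/-- The operator `A ⊗ 1` acting trivially on the last tensor factor. -/
def extendLast {n : ℕ} (A : Matrix (Fin n → I) (Fin n → I) ℂ) :
    Matrix (Fin (n + 1) → I) (Fin (n + 1) → I) ℂ :=
  (Matrix.kroneckerMap (· * ·) (1 : Matrix I I ℂ) A).submatrix
    (Fin.insertNthEquiv (fun _ => I) (Fin.last n)).symm
    (Fin.insertNthEquiv (fun _ => I) (Fin.last n)).symm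

lemma extendLast_posSemidef {n : ℕ} {A : Matrix (Fin n → I) (Fin n → I) ℂ} (hA : A.PosSemidef) :
    (extendLast A).PosSemidef := (PosSemidef.one.kronecker hA).submatrix _

lemma one_sub_extendLast {n : ℕ} (A : Matrix (Fin n → I) (Fin n → I) ℂ) :
    1 - extendLast A = extendLast (1 - A) := by
  ext x y
  have h1 : (1 : Matrix (Fin (n + 1) → I) (Fin (n + 1) → I) ℂ) = extendLast 1 := by
    unfold extendLast
    rw [Matrix.kroneckerMap_one_one _ (by simp) (by simp) (by simp), submatrix_one_equiv]
  rw [h1]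
  simp only [extendLast, Matrix.sub_apply, submatrix_apply, kroneckerMap_apply]
  ring

lemma trace_submatrix_equiv {m n : Type*} [Fintype m] [Fintype n] (e : m ≃ n)
    (A : Matrix n n ℂ) : (A.submatrix e e).trace = A.trace :=
  Equiv.sum_comp e fun i => A i i

lemma trace_extendLast_mul {n : ℕ} (A : Matrix (Fin n → I) (Fin n → I) ℂ)
    (ω : Matrix (Fin (n + 1) → I) (Fin (n + 1) → I) ℂ) :
    (extendLast A * ω).trace = (A * ptraceAt (Fin.last n) ω).trace := by
  set e := Fin.insertNthEquiv (fun _ => I) (Fin.last n)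
  have h : (extendLast A * ω).trace =
      ((Matrix.kroneckerMap (· * ·) (1 : Matrix I I ℂ) A) * ω.submatrix e e).trace := by
    rw [← trace_submatrix_equiv e, ← submatrix_mul_equiv _ _ _ e]
    simp [extendLast, e]
  rw [h]
  simp only [trace, diag, Matrix.mul_apply, Fintype.sum_prod_type, kroneckerMap_apply, ptraceAt,
    submatrix_apply, Matrix.one_apply, ite_mul, one_mul, zero_mul, Finset.sum_ite_irrel,
    Finset.sum_const_zero, Finset.sum_ite_eq, Finset.mem_univ, if_true, Finset.mul_sum]
  rw [Finset.sum_comm]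
  refine Finset.sum_congr rfl fun x _ => ?_
  rw [Finset.sum_comm]
  rfl

lemma ptraceAt_last_tpow {ρ : Matrix I I ℂ} (hρ : IsState ρ) (n : ℕ) :
    ptraceAt (Fin.last n) (tpow ρ (n + 1)) = tpow ρ n := by
  ext x y
  have := hρ.2
  simp only [ptraceAt, tpow, Fin.prod_univ_castSucc, Fin.insertNth_last', Fin.snoc_castSucc, Fin.snoc_last]
  rw [← Finset.mul_sum]
  rw [trace] at this
  simp only [diag] at this
  rw [this, mul_one]

/-! ### Distinguishability of a state from a set -/

/-- Some test accepts `ρ` with probability at least `1 - η` plus `l` times its acceptance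
probability on any element of `S`. -/
def Distinguishable (S : Set (Matrix I I ℂ)) (ρ : Matrix I I ℂ) (l η : ℝ) : Prop :=
  ∃ A ∈ tests I, ∀ ω ∈ S, 1 - η ≤ expect ρ A - l * expect ω A

lemma Distinguishable.mono {S : Set (Matrix I I ℂ)} (hst : ∀ ω ∈ S, IsState ω)
    {ρ : Matrix I I ℂ} {l l' η η' : ℝ} (h : Distinguishable S ρ l η) (hl : l' ≤ l) (hη : η ≤ η') :
    Distinguishable S ρ l' η' := by
  obtain ⟨A, hA, h⟩ := h
  refine ⟨A, hA, fun ω hω => ?_⟩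
  have h1 := mul_le_mul_of_nonneg_right hl (expect_nonneg hA.1 (hst ω hω).1)
  have h2 := h ω hω
  linarith

lemma Distinguishable.succ {d : ℕ} {σ : Matrix (Fin d) (Fin d) ℂ}
    {M : ∀ n : ℕ, Set (Matrix (Fin n → Fin d) (Fin n → Fin d) ℂ)} (hM : GoodFamily σ M)
    {ρ : Matrix (Fin d) (Fin d) ℂ} (hρ : IsState ρ) {n : ℕ} {l η : ℝ}
    (h : Distinguishable (M n) (tpow ρ n) l η) :
    Distinguishable (M (n + 1)) (tpow ρ (n + 1)) l η := by
  obtain ⟨A, hA, h⟩ := h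
  refine ⟨extendLast A, ⟨extendLast_posSemidef hA.1, ?_⟩, fun ω hω => ?_⟩
  · rw [one_sub_extendLast]
    exact extendLast_posSemidef hA.2
  · have := h _ (hM.ptrace_mem n (Fin.last n) ω hω)
    simpa only [expect_apply, trace_extendLast_mul, ptraceAt_last_tpow hρ] using this

lemma Distinguishable.add {d : ℕ} {σ : Matrix (Fin d) (Fin d) ℂ}
    {M : ∀ n : ℕ, Set (Matrix (Fin n → Fin d) (Fin n → Fin d) ℂ)} (hM : GoodFamily σ M)
    {ρ : Matrix (Fin d) (Fin d) ℂ} (hρ : IsState ρ) {n : ℕ} {l η : ℝ}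
    (h : Distinguishable (M n) (tpow ρ n) l η) (r : ℕ) :
    Distinguishable (M (n + r)) (tpow ρ (n + r)) l η := by
  induction r with
  | zero => exact h
  | succ r ih => exact ih.succ hM hρ

/-! ### Regrouping tensor powers -/

lemma exists_regroup {d : ℕ} {σ : Matrix (Fin d) (Fin d) ℂ}
    {M : ∀ n : ℕ, Set (Matrix (Fin n → Fin d) (Fin n → Fin d) ℂ)} (hM : GoodFamily σ M)
    (m k : ℕ) : ∃ e : (Fin (m * k) → Fin d) ≃ (Fin k → Fin m → Fin d),
      (∀ ρ : Matrix (Fin d) (Fin d) ℂ,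
        (tpow (tpow ρ m) k).submatrix e e = tpow ρ (m * k)) ∧
      ∀ τ ∈ M m, (tpow τ k).submatrix e e ∈ M (m * k) := by
  induction k with
  | zero =>
    refine ⟨(Equiv.ofUnique _ _ : (Fin 0 → Fin d) ≃ (Fin 0 → Fin m → Fin d)), fun ρ => ?_,
      fun τ _ => ?_⟩
    · ext x y
      simp [tpow]
    · have h : (tpow τ 0).submatrix (Equiv.ofUnique (Fin 0 → Fin d) (Fin 0 → Fin m → Fin d))
          (Equiv.ofUnique _ _) = tpow σ 0 := by
        ext x y
        simp [tpow]
      have h0 := hM.sigma_mem 0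
      rw [← h] at h0
      exact h0
  | succ k ih =>
    obtain ⟨e, h1, h2⟩ := ih
    have key : ∀ τ : Matrix (Fin m → Fin d) (Fin m → Fin d) ℂ,
        (tpow τ (k + 1)).submatrix
          ((Fin.appendEquiv (m * k) m).symm.trans ((e.prodCongr (Equiv.refl _)).trans
            ((Equiv.prodComm _ _).trans (Fin.snocEquiv fun _ => Fin m → Fin d))))
          ((Fin.appendEquiv (m * k) m).symm.trans ((e.prodCongr (Equiv.refl _)).trans
            ((Equiv.prodComm _ _).trans (Fin.snocEquiv fun _ => Fin m → Fin d)))) =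
        tprod ((tpow τ k).submatrix e e) τ := by
      intro τ
      ext x y
      simp [tpow, tprod, Fin.prod_univ_castSucc, Fin.appendEquiv]
    refine ⟨_, fun ρ => (key _).trans ?_, fun τ hτ => ?_⟩
    · rw [h1]
      ext x y
      simp only [tprod, tpow]
      exact (Fin.prod_univ_add fun i : Fin (m * k + m) => ρ (x i) (y i)).symm
    · rw [key]
      exact hM.tprod_mem _ _ _ (h2 τ hτ) _ hτ

/-! ### Entropies -/

lemma relEnt_eq (ρ σ : Matrix I I ℂ) :
    relEnt ρ σ = -vnEnt ρ - ((ρ * mlog σ).trace).re := by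
  simp [relEnt, vnEnt, Matrix.mul_sub]

lemma sum_sum_mul_prod {f w : I → ℝ} (hw : ∑ i, w i = 1) (n : ℕ) :
    ∑ x : Fin n → I, (∑ j, f (x j)) * ∏ i, w (x i) = n * ∑ i, f i * w i := by
  simp_rw [Finset.sum_mul]
  rw [Finset.sum_comm]
  have : ∀ j : Fin n, ∑ x : Fin n → I, f (x j) * ∏ i, w (x i) = ∑ i, f i * w i := fun j => by
    have h := Finset.prod_univ_sum (fun _ : Fin n => (Finset.univ : Finset I))
      (fun i a => if i = j then f a * w a else w a)
    rw [Fintype.piFinset_univ] at h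
    have h1 : ∀ x : Fin n → I, (∏ i, if i = j then f (x i) * w (x i) else w (x i)) =
        f (x j) * ∏ i, w (x i) := fun x => by
      have : ∀ i, (if i = j then f (x i) * w (x i) else w (x i)) =
          (if i = j then f (x i) else 1) * w (x i) := fun i => by split_ifs <;> simp
      simp_rw [this, Finset.prod_mul_distrib]
      simp
    simp_rw [h1] at h
    rw [← h, Finset.prod_eq_single j]
    · simp
    · intro i _ hi
      simp [hi, hw]
    · simp
  simp [this]

lemma vnEnt_diagConj {U : Matrix I I ℂ} (hU : U ∈ unitaryGroup I ℂ) {a : I → ℝ}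
    (ha : ∀ i, 0 ≤ a i) : vnEnt (diagConj U a) = -∑ i, Real.logb 2 (a i) * a i := by
  rw [vnEnt, trace_mul_mlog_diagConj hU]
  congr 1
  refine Finset.sum_congr rfl fun i _ => ?_
  rw [weight_diagConj hU]
  rcases (ha i).eq_or_lt with h | h
  · simp [← h]
  · simp [h]

lemma vnEnt_tpow {ρ : Matrix I I ℂ} (hρ : IsState ρ) (n : ℕ) :
    vnEnt (tpow ρ n) = n * vnEnt ρ := by
  obtain ⟨U, hU, a, ha, rfl⟩ := exists_eq_diagConj hρ.1
  have hsum : ∑ i, a i = 1 := by rw [sum_eq_re_trace_diagConj hU, hρ.2, Complex.one_re]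
  rw [tpow_diagConj, vnEnt_diagConj hU ha, vnEnt_diagConj (tpow_mem_unitaryGroup hU n)
    fun x => Finset.prod_nonneg fun i _ => ha _, mul_neg, ← sum_sum_mul_prod hsum]
  congr 1
  refine Finset.sum_congr rfl fun x _ => ?_
  by_cases h : ∃ i, a (x i) = 0
  · obtain ⟨i, hi⟩ := h
    have : ∏ i, a (x i) = 0 := Finset.prod_eq_zero (Finset.mem_univ i) hi
    simp [this]
  · push Not at h
    rw [Real.logb_prod _ _ fun i _ => h i]

lemma IsState.re_trace_mul_mlog_nonpos {ρ σ : Matrix I I ℂ} (hρ : ρ.PosSemidef) (hσ : IsState σ) :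
    ((ρ * mlog σ).trace).re ≤ 0 := by
  obtain ⟨U, hU, a, ha, rfl⟩ := exists_eq_diagConj hσ.1
  rw [trace_mul_mlog_diagConj hU]
  refine Finset.sum_nonpos fun i _ => mul_nonpos_of_nonpos_of_nonneg ?_ (weight_nonneg hρ U i)
  split_ifs with h
  · exact Real.logb_nonpos one_lt_two h.le (hσ.diagConj_le_one hU ha i)
  · exact le_rfl

lemma bddBelow_relEnt {S : Set (Matrix I I ℂ)} (hst : ∀ ω ∈ S, IsState ω) {ρ : Matrix I I ℂ}
    (hρ : ρ.PosSemidef) : BddBelow {x | ∃ σ ∈ S, SuppLe ρ σ ∧ x = relEnt ρ σ} := by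
  refine ⟨-vnEnt ρ, ?_⟩
  rintro _ ⟨σ, hσ, _, rfl⟩
  rw [relEnt_eq]
  linarith [IsState.re_trace_mul_mlog_nonpos hρ (hst σ hσ)]

lemma EMset_le_relEnt {S : Set (Matrix I I ℂ)} (hst : ∀ ω ∈ S, IsState ω) {ρ σ : Matrix I I ℂ}
    (hρ : ρ.PosSemidef) (hσ : σ ∈ S) (hs : SuppLe ρ σ) : EMset S ρ ≤ relEnt ρ σ :=
  csInf_le (bddBelow_relEnt hst hρ) ⟨σ, hσ, hs, rfl⟩

lemma SuppLe.of_diagConj {U : Matrix I I ℂ} (hU : U ∈ unitaryGroup I ℂ) {a : I → ℝ}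
    (ha : ∀ i, 0 < a i) (ρ : Matrix I I ℂ) : SuppLe ρ (diagConj U a) := by
  intro v hv
  have h : diagConj U (fun i => (a i)⁻¹) * diagConj U a = 1 := by
    rw [diagConj_mul hU, ← diagConj_one hU]
    congr 1
    ext i
    exact inv_mul_cancel₀ (ha i).ne'
  have : v = 0 := by rw [← one_mulVec v, ← h, ← mulVec_mulVec, hv, mulVec_zero]
  rw [this, mulVec_zero]

lemma SuppLe.of_sub_smul_one {κ : Matrix I I ℂ} (hκ : κ.PosSemidef) {c : ℝ} (hc : 0 < c)
    (h : (κ - c • (1 : Matrix I I ℂ)).PosSemidef) (ρ : Matrix I I ℂ) : SuppLe ρ κ := by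
  obtain ⟨U, hU, a, _, rfl⟩ := exists_eq_diagConj hκ
  exact SuppLe.of_diagConj hU (fun i => hc.trans_le (le_of_diagConj_sub_smul_one hU h i)) ρ

lemma exists_pow_smul_one_le_tpow {σ : Matrix I I ℂ} (hσ : σ.PosDef) :
    ∃ μ : ℝ, 0 < μ ∧ ∀ n : ℕ,
      (tpow σ n - μ ^ n • (1 : Matrix (Fin n → I) (Fin n → I) ℂ)).PosSemidef := by
  obtain ⟨μ, hμ, hle⟩ : ∃ μ : ℝ, 0 < μ ∧ ∀ i, μ ≤ hσ.isHermitian.eigenvalues i := by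
    rcases isEmpty_or_nonempty I with h | h
    · exact ⟨1, one_pos, fun i => h.elim i⟩
    · obtain ⟨i, hi⟩ := Finite.exists_min hσ.isHermitian.eigenvalues
      exact ⟨_, hσ.eigenvalues_pos i, hi⟩
  refine ⟨μ, hμ, fun n => ?_⟩
  have hU : (hσ.isHermitian.eigenvectorUnitary : Matrix I I ℂ) ∈ unitaryGroup I ℂ :=
    SetLike.coe_mem _
  rw [eq_diagConj hσ.isHermitian, tpow_diagConj, ← diagConj_one (tpow_mem_unitaryGroup hU n),
    smul_diagConj, diagConj_sub]
  refine diagConj_posSemidef _ fun x => ?_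
  have := Finset.prod_le_prod (s := Finset.univ) (f := fun _ : Fin n => μ)
    (g := fun i => hσ.isHermitian.eigenvalues (x i)) (fun _ _ => hμ.le) fun i _ => hle _
  simpa using this

/-- If `ρ` is not distinguishable from `S`, then mixing the indistinguishable element with good
candidates for `τ` and `κ` yields an element of `S` of small relative entropy. -/
lemma EMset_le_of_not_distinguishable {S : Set (Matrix I I ℂ)} (hS : Convex ℝ S)
    (hSc : IsClosed S) (hst : ∀ ω ∈ S, IsState ω) {ρ κ τ Q R : Matrix I I ℂ} (hρ : IsState ρ)
    (hκ : κ ∈ S) (hτ : τ ∈ S) (hQ : Q.IsHermitian) (hQQ : Q * Q = Q) (hQρ : Q * ρ = ρ * Q)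
    (hR : R.IsHermitian) (hRR : R * R = R) {l η a b c β : ℝ} (hl : 0 ≤ l) (hβ : 0 < β)
    (hab : a ≤ b) (hbc : b ≤ c) (hτR : (τ - β • R).PosSemidef)
    (hκc : (κ - (3 * (2 : ℝ) ^ (-c)) • (1 : Matrix I I ℂ)).PosSemidef)
    (hnot : ¬ Distinguishable S ρ l η) :
    EMset S ρ ≤ -vnEnt ρ + (a + (b - a) * (1 - η / 2 +
      3 / 2 * (l * (2 : ℝ) ^ (-a) * (Q.trace).re) + expect ρ (1 - Q)) +
      (c - b) * (2 * (3 * (2 : ℝ) ^ (-b) / β) + 2 * expect ρ (1 - R))) := by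
  obtain ⟨ω, hω, htest⟩ := (exists_test_or_exists_indistinguishable hS hSc ⟨κ, hκ⟩ hst ρ l
    (1 - η)).resolve_left hnot
  set σ : Matrix I I ℂ := (1 / 3 : ℝ) • ω + (2 / 3 : ℝ) • ((1 / 2 : ℝ) • τ + (1 / 2 : ℝ) • κ)
    with hσ
  have hσS : σ ∈ S := hS hω (hS hτ hκ (by norm_num) (by norm_num) (by norm_num))
    (by norm_num) (by norm_num) (by norm_num)
  have h3 : (3 : ℝ) • σ = ω + τ + κ := by
    rw [hσ]
    module
  have hωp := (hst ω hω).1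
  have hτp := (hst τ hτ).1
  have hκp := (hst κ hκ).1
  have h3ω : ((3 : ℝ) • σ - ω).PosSemidef := by
    rw [h3, show ω + τ + κ - ω = τ + κ by abel]
    exact hτp.add hκp
  have h3τ : ((3 : ℝ) • σ - τ).PosSemidef := by
    rw [h3, show ω + τ + κ - τ = ω + κ by abel]
    exact hωp.add hκp
  have hlow : (σ - (2 : ℝ) ^ (-c) • (1 : Matrix I I ℂ)).PosSemidef := by
    have : σ - (2 : ℝ) ^ (-c) • (1 : Matrix I I ℂ) = (1 / 3 : ℝ) • (ω + τ +
        (κ - (3 * (2 : ℝ) ^ (-c)) • (1 : Matrix I I ℂ))) := by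
      rw [hσ]
      module
    rw [this]
    exact PosSemidef.smul_real ((hωp.add hτp).add hκc) (by norm_num)
  have hc0 : (0 : ℝ) < (2 : ℝ) ^ (-c) := by positivity
  have hsupp : SuppLe ρ σ := SuppLe.of_sub_smul_one (hst σ hσS).1 hc0 hlow ρ
  refine (EMset_le_relEnt hst hρ.1 hσS hsupp).trans ?_
  rw [relEnt_eq, sub_eq_add_neg]
  gcongr
  clear_value σ
  obtain ⟨U, hU, s, hs, rfl⟩ := exists_eq_diagConj (hst σ hσS).1
  have hs0 : ∀ i, (2 : ℝ) ^ (-c) ≤ s i := le_of_diagConj_sub_smul_one hU hlow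
  have hs1 : ∀ i, 0 < s i := fun i => hc0.trans_le (hs0 i)
  set f : I → ℝ := fun i => -Real.logb 2 (s i) with hf
  have hfc : ∀ i, f i ≤ c := fun i => by
    have := (Real.le_logb_iff_rpow_le one_lt_two (hs1 i)).2 (hs0 i)
    simp only [hf]
    linarith
  set T : ℝ → Matrix I I ℂ := fun t => diagConj U fun i => if t ≤ f i then 1 else 0 with hT
  have hTh : ∀ t, (T t).IsHermitian := fun t => diagConj_isHermitian _ _
  have hTT : ∀ t, T t * T t = T t := fun t => by
    rw [hT]
    simp only [diagConj_mul hU]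
    congr 1
    ext i
    simp
  have hTσ : ∀ t, ((2 : ℝ) ^ (-t) • T t - T t * diagConj U s * T t).PosSemidef := fun t => by
    rw [hT]
    simp only [diagConj_mul hU, smul_diagConj, diagConj_sub]
    refine diagConj_posSemidef _ fun i => ?_
    by_cases h : t ≤ f i
    · have : s i ≤ (2 : ℝ) ^ (-t) :=
        (Real.logb_le_iff_le_rpow one_lt_two (hs1 i)).1 (by simp only [hf] at h; linarith)
      simpa [h] using this
    · simp [h]
  have hexp : ∀ t, expect ρ (T t) = ∑ i, (if t ≤ f i then 1 else 0) * weight ρ U i := fun t =>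
    expect_diagConj _ _ _
  have ha := expect_le_of_indistinguishable hρ (hTh a) (hTT a) hQ hQQ hQρ
    (by positivity) hl h3ω (hTσ a) fun A h0 h1 => htest A ⟨h0, h1⟩
  have hb := expect_le_of_large_eigenvalues hρ (hTh b) (hTT b) hR hRR hβ
    (by positivity) hτR h3τ (hTσ b)
  have hw1 : ∑ i, weight ρ U i = 1 := by rw [sum_weight hU, hρ.2, Complex.one_re]
  have hsum := sum_mul_le_of_tails (weight_nonneg hρ.1 U) hw1 hab hfc
  rw [← hexp, ← hexp] at hsum
  have hlhs : -((ρ * mlog (diagConj U s)).trace).re = ∑ i, f i * weight ρ U i := by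
    rw [trace_mul_mlog_diagConj hU]
    simp [hf, hs1]
  rw [hlhs]
  have h1 := mul_le_mul_of_nonneg_left ha (sub_nonneg.2 hab)
  have h2 := mul_le_mul_of_nonneg_left hb (sub_nonneg.2 hbc)
  linarith

/-! ### Asymptotics -/

lemma expect_submatrix {J : Type*} [Fintype J] [DecidableEq J] (e : J ≃ I) (ρ A : Matrix I I ℂ) :
    expect (ρ.submatrix e e) (A.submatrix e e) = expect ρ A := by
  rw [expect_apply, submatrix_mul_equiv, trace_submatrix_equiv, expect_apply]

lemma trace_le_of_smul_le {ρ Q : Matrix I I ℂ} (hρ : IsState ρ) {x : ℝ}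
    (h : (ρ - (2 : ℝ) ^ (-x) • Q).PosSemidef) : (Q.trace).re ≤ (2 : ℝ) ^ x := by
  have h1 : 0 ≤ ((ρ - (2 : ℝ) ^ (-x) • Q).trace).re := (Complex.le_def.1 h.trace_nonneg).1
  rw [trace_sub, trace_smul, hρ.2, Complex.sub_re, Complex.one_re, Complex.smul_re, smul_eq_mul,
    Real.rpow_neg two_pos.le, sub_nonneg, inv_mul_le_iff₀ (by positivity), mul_one] at h1
  exact h1

lemma exists_relEnt_lt_of_EMset_lt {d : ℕ} {σ : Matrix (Fin d) (Fin d) ℂ}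
    {M : ∀ n : ℕ, Set (Matrix (Fin n → Fin d) (Fin n → Fin d) ℂ)} (hM : GoodFamily σ M) {n : ℕ}
    {ρ : Matrix (Fin n → Fin d) (Fin n → Fin d) ℂ} {x : ℝ} (h : EMset (M n) ρ < x) :
    ∃ τ ∈ M n, SuppLe ρ τ ∧ relEnt ρ τ < x := by
  obtain ⟨μ, hμ, hμσ⟩ := exists_pow_smul_one_le_tpow hM.sigma_posdef
  have hne : {x | ∃ σ ∈ M n, SuppLe ρ σ ∧ x = relEnt ρ σ}.Nonempty :=
    ⟨_, tpow σ n, hM.sigma_mem n, SuppLe.of_sub_smul_one (hM.sigma_state.tpow n).1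
      (pow_pos hμ n) (hμσ n) ρ, rfl⟩
  obtain ⟨_, ⟨τ, hτ, hs, rfl⟩, hlt⟩ := exists_lt_of_csInf_lt hne h
  exact ⟨τ, hτ, hs, hlt⟩

lemma tendsto_two_rpow_neg_mul {m : ℕ} (hm : 0 < m) {δ : ℝ} (hδ : 0 < δ) :
    Tendsto (fun k : ℕ => (2 : ℝ) ^ (-(((m * k : ℕ) : ℝ) * δ))) atTop (nhds 0) := by
  have h1 : Tendsto (fun k : ℕ => m * k) atTop atTop :=
    tendsto_id.const_mul_atTop' hm
  have h2 : Tendsto (fun k : ℕ => ((m * k : ℕ) : ℝ) * δ) atTop atTop :=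
    (tendsto_natCast_atTop_atTop.comp h1).atTop_mul_const hδ
  exact (tendsto_rpow_atBot_of_base_gt_one 2 one_lt_two).comp (tendsto_neg_atTop_atBot.comp h2)

/-- Along multiples of a suitable block length, `ρ^{⊗n}` is distinguishable from `M n` at every
rate below the regularized relative entropy. -/
lemma exists_eventually_distinguishable_mul {d : ℕ} {σ : Matrix (Fin d) (Fin d) ℂ}
    {M : ∀ n : ℕ, Set (Matrix (Fin n → Fin d) (Fin n → Fin d) ℂ)} (hM : GoodFamily σ M)
    {ρ : Matrix (Fin d) (Fin d) ℂ} (hρ : IsState ρ) {E : ℝ}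
    (hE : Tendsto (fun n : ℕ => EMset (M n) (tpow ρ n) / n) atTop (nhds E)) {r η : ℝ}
    (hr : r < E) (hη : 0 < η) :
    ∃ m : ℕ, 0 < m ∧ ∀ᶠ k : ℕ in atTop,
      Distinguishable (M (m * k)) (tpow ρ (m * k)) ((2 : ℝ) ^ (((m * k : ℕ) : ℝ) * r)) η := by
  set s := vnEnt ρ with hs
  set δ := (E - r) * η / 8 with hδ
  have hδ0 : 0 < δ := by
    have := sub_pos.2 hr
    positivity
  obtain ⟨m, hmE, hm⟩ := ((hE.eventually (gt_mem_nhds (show E < E + δ / 2 by linarith))).and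
    (eventually_gt_atTop 0)).exists
  have hmR : (0 : ℝ) < m := Nat.cast_pos.2 hm
  rw [div_lt_iff₀ hmR] at hmE
  obtain ⟨τ, hτ, hsupp, hτE⟩ := exists_relEnt_lt_of_EMset_lt hM hmE
  rw [relEnt_eq, vnEnt_tpow hρ, ← hs] at hτE
  obtain ⟨Q, hQ, hQt⟩ := exists_typical_projection hρ hρ.1 (fun _ h => h) hδ0
  obtain ⟨R, hR, hRt⟩ := exists_typical_projection (hρ.tpow m) (hM.states m τ hτ).1 hsupp
    (show 0 < m * δ / 2 by positivity)
  choose e heρ heM using exists_regroup hM m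
  obtain ⟨μ, hμ, hμσ⟩ := exists_pow_smul_one_le_tpow hM.sigma_posdef
  set C := max (E + s + 2 * δ) (2 - Real.logb 2 μ) with hC
  refine ⟨m, hm, ?_⟩
  have hmk : Tendsto (fun k : ℕ => m * k) atTop atTop := tendsto_id.const_mul_atTop' hm
  have hlim : Tendsto (fun k : ℕ => -s + (r + s + 2 * δ + (E - r) * (1 - η / 2 +
      3 / 2 * (2 : ℝ) ^ (-(((m * k : ℕ) : ℝ) * δ)) + expect (tpow ρ (m * k)) (1 - Q (m * k))) +
      (C - (E + s + 2 * δ)) * (2 * (3 * (2 : ℝ) ^ (-(((m * k : ℕ) : ℝ) * δ))) +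
        2 * expect (tpow (tpow ρ m) k) (1 - R k)))) atTop
      (nhds (-s + (r + s + 2 * δ + (E - r) * (1 - η / 2 + 3 / 2 * 0 + 0) +
        (C - (E + s + 2 * δ)) * (2 * (3 * 0) + 2 * 0)))) := by
    have h2 := tendsto_two_rpow_neg_mul hm hδ0
    have hQ' := hQt.comp hmk
    exact ((((tendsto_const_nhds.add (h2.const_mul _)).add hQ').const_mul _).const_add _ |>.add
      ((((h2.const_mul _).const_mul _).add (hRt.const_mul _)).const_mul _)).const_add _
  have hlt : -s + (r + s + 2 * δ + (E - r) * (1 - η / 2 + 3 / 2 * 0 + 0) +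
        (C - (E + s + 2 * δ)) * (2 * (3 * 0) + 2 * 0)) < E := by
    have : (E - r) * η = 8 * δ := by rw [hδ]; ring
    linarith
  filter_upwards [hlim.eventually_lt (hE.comp hmk) hlt, eventually_gt_atTop 0] with k hk hk0
  by_contra hnot
  set n := m * k with hn
  have hn0 : (0 : ℝ) < n := Nat.cast_pos.2 (Nat.mul_pos hm hk0)
  have hn1 : (1 : ℝ) ≤ n := Nat.one_le_cast.2 (Nat.mul_pos hm hk0)
  have hnmk : (n : ℝ) = m * k := by rw [hn]; push_cast; ring
  refine absurd hk (not_lt.2 ?_)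
  obtain ⟨hQh, hQQ, hQρ, hQp⟩ := hQ n
  obtain ⟨hRh, hRR, -, hRp⟩ := hR k
  have hRproj := posSemidef_of_isHermitian_of_mul_self hRh hRR
  have hτR : ((tpow τ k).submatrix (e k) (e k) -
      (2 : ℝ) ^ (-(n * (E + s + δ))) • (R k).submatrix (e k) (e k)).PosSemidef := by
    have hle : (2 : ℝ) ^ (-(n * (E + s + δ))) ≤
        (2 : ℝ) ^ (-(k * (-((tpow ρ m * mlog τ).trace).re + m * δ / 2))) := by
      refine Real.rpow_le_rpow_of_exponent_le one_le_two (neg_le_neg ?_)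
      rw [hnmk, mul_comm (m : ℝ) k, mul_assoc]
      refine mul_le_mul_of_nonneg_left ?_ (Nat.cast_nonneg (α := ℝ) k)
      linarith
    have := (hRp.add (PosSemidef.smul_real hRproj (sub_nonneg.2 hle))).submatrix (e k)
    convert this using 1
    ext x y
    simp only [Matrix.sub_apply, Matrix.add_apply, Matrix.smul_apply, submatrix_apply, sub_smul]
    abel
  have hκ : (tpow σ n - (3 * (2 : ℝ) ^ (-(n * C))) •
      (1 : Matrix (Fin n → Fin d) (Fin n → Fin d) ℂ)).PosSemidef := by
    have hle : 3 * (2 : ℝ) ^ (-(n * C)) ≤ μ ^ n := by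
      have h1 : (2 : ℝ) ^ (-(n * C)) ≤ (2 : ℝ) ^ (-2 + n * Real.logb 2 μ) := by
        refine Real.rpow_le_rpow_of_exponent_le one_le_two ?_
        have := mul_le_mul_of_nonneg_left (le_max_right (E + s + 2 * δ) (2 - Real.logb 2 μ)) hn0.le
        rw [← hC] at this
        nlinarith
      have h2 : (2 : ℝ) ^ (-2 + n * Real.logb 2 μ) = 1 / 4 * μ ^ n := by
        rw [Real.rpow_add two_pos, mul_comm (n : ℝ), Real.rpow_mul two_pos.le,
          Real.rpow_logb two_pos (by norm_num) hμ, Real.rpow_natCast]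
        norm_num
      have h3 := pow_pos hμ n
      linarith
    have := (hμσ n).add (PosSemidef.smul_real (PosSemidef.one (n := Fin n → Fin d) (R := ℂ))
      (sub_nonneg.2 hle))
    convert this using 1
    rw [sub_smul]
    abel
  have key := EMset_le_of_not_distinguishable (hM.convex n) (hM.closed n) (hM.states n)
    (hρ.tpow n) (hM.sigma_mem n) (heM k τ hτ) hQh hQQ hQρ (hRh.submatrix _)
    (R := (R k).submatrix (e k) (e k)) (by rw [submatrix_mul_equiv, hRR])
    (l := (2 : ℝ) ^ ((n : ℝ) * r)) (η := η) (a := n * (r + s + 2 * δ))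
    (b := n * (E + s + 2 * δ)) (c := n * C)
    (by positivity) (by positivity)
    (mul_le_mul_of_nonneg_left (by linarith) hn0.le)
    (mul_le_mul_of_nonneg_left (le_max_left _ _) hn0.le) hτR hκ hnot
  have hR1 : expect (tpow ρ n) (1 - (R k).submatrix (e k) (e k)) =
      expect (tpow (tpow ρ m) k) (1 - R k) := by
    rw [← expect_submatrix (e k), heρ]
    congr 1
    rw [Matrix.submatrix_sub, Pi.sub_apply, Pi.sub_apply, submatrix_one_equiv]
  have hQ1 : (2 : ℝ) ^ ((n : ℝ) * r) * (2 : ℝ) ^ (-(n * (r + s + 2 * δ))) * ((Q n).trace).re ≤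
      (2 : ℝ) ^ (-((n : ℝ) * δ)) := by
    have h1 := trace_le_of_smul_le (hρ.tpow n) hQp
    refine (mul_le_mul_of_nonneg_left h1 (by positivity)).trans (le_of_eq ?_)
    rw [← Real.rpow_add two_pos, ← Real.rpow_add two_pos]
    congr 1
    rw [hs, vnEnt]
    ring
  have hb1 : 3 * (2 : ℝ) ^ (-(n * (E + s + 2 * δ))) / (2 : ℝ) ^ (-(n * (E + s + δ))) =
      3 * (2 : ℝ) ^ (-((n : ℝ) * δ)) := by
    rw [mul_div_assoc, ← Real.rpow_sub two_pos]
    congr 2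
    ring
  rw [hR1, hb1, vnEnt_tpow hρ, ← hs] at key
  simp only [Function.comp_apply]
  rw [div_le_iff₀ hn0]
  refine key.trans ?_
  have := mul_le_mul_of_nonneg_left hQ1 (mul_nonneg hn0.le (sub_nonneg.2 hr.le))
  linarith

lemma eventually_distinguishable {d : ℕ} {σ : Matrix (Fin d) (Fin d) ℂ}
    {M : ∀ n : ℕ, Set (Matrix (Fin n → Fin d) (Fin n → Fin d) ℂ)} (hM : GoodFamily σ M)
    {ρ : Matrix (Fin d) (Fin d) ℂ} (hρ : IsState ρ) {E : ℝ}
    (hE : Tendsto (fun n : ℕ => EMset (M n) (tpow ρ n) / n) atTop (nhds E)) {r η : ℝ}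
    (hr0 : 0 < r) (hr : r < E) (hη : 0 < η) :
    ∀ᶠ n : ℕ in atTop, Distinguishable (M n) (tpow ρ n) ((2 : ℝ) ^ ((n : ℝ) * r)) η := by
  obtain ⟨r', hrr', hr'⟩ := exists_between hr
  obtain ⟨m, hm, hk⟩ := exists_eventually_distinguishable_mul hM hρ hE hr' hη
  have hlin : Tendsto (fun n : ℕ => (n : ℝ) * (r' - r)) atTop atTop :=
    tendsto_natCast_atTop_atTop.atTop_mul_const (sub_pos.2 hrr')
  filter_upwards [(Nat.tendsto_div_const_atTop hm.ne').eventually hk,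
    hlin.eventually_ge_atTop (m * r')] with n hn hnm
  have h := hn.add hM hρ (n % m)
  rw [Nat.div_add_mod] at h
  refine h.mono (hM.states n) (Real.rpow_le_rpow_of_exponent_le one_le_two ?_) le_rfl
  have hlt : (n : ℝ) ≤ ((m * (n / m) : ℕ) : ℝ) + m := by
    rw [← Nat.cast_add, Nat.cast_le]
    have h1 := Nat.div_add_mod n m
    have h2 := Nat.mod_lt n hm
    lia
  have := mul_le_mul_of_nonneg_right hlt (hr0.trans hrr').le
  linarith

lemma exists_tendsto_zero_of_eventually {P : ℕ → ℝ → Prop}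
    (hmono : ∀ n η η', η ≤ η' → P n η → P n η') (hone : ∀ n, P n 1)
    (h : ∀ η, 0 < η → ∀ᶠ n in atTop, P n η) :
    ∃ e : ℕ → ℝ, Tendsto e atTop (nhds 0) ∧ ∀ n, P n (e n) := by
  set s : ℕ → Set ℝ := fun n => {η | 0 ≤ η ∧ P n η}
  have hbdd : ∀ n, BddBelow (s n) := fun n => ⟨0, fun _ hη => hη.1⟩
  have hne : ∀ n, (s n).Nonempty := fun n => ⟨1, zero_le_one, hone n⟩
  have hs : Tendsto (fun n => sInf (s n)) atTop (nhds 0) := by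
    refine tendsto_order.2 ⟨fun x hx => Eventually.of_forall fun n =>
      hx.trans_le (le_csInf (hne n) fun _ hη => hη.1), fun x hx => ?_⟩
    filter_upwards [h (x / 2) (half_pos hx)] with n hn
    exact (csInf_le (hbdd n) ⟨(half_pos hx).le, hn⟩).trans_lt (half_lt_self hx)
  refine ⟨fun n => sInf (s n) + 1 / ((n : ℝ) + 1), ?_, fun n => ?_⟩
  · simpa using hs.add tendsto_one_div_add_atTop_nhds_zero_nat
  · obtain ⟨η, hη, hlt⟩ := exists_lt_of_csInf_lt (hne n)
      (lt_add_of_pos_right (sInf (s n)) (Nat.one_div_pos_of_nat (α := ℝ) (n := n)))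
    exact hmono n _ _ hlt.le hη.2

lemma Distinguishable.one (S : Set (Matrix I I ℂ)) (ρ : Matrix I I ℂ) (l : ℝ) :
    Distinguishable S ρ l 1 :=
  ⟨0, zero_mem_tests, fun ω _ => by simp⟩

/-- **Generalized quantum Stein's Lemma, direct part.**  For a family `{M n}` satisfying
properties 1–5 and a state `ρ`, with `E = E_M^∞(ρ)` the regularized relative entropy,
for every `ε > 0` there is a sequence of POVM elements `0 ≤ A n ≤ 1` with
`tr((1 − A n) ρ^{⊗n}) → 0` and `−(1/n) log₂ tr(A n ω) + ε ≥ E` for every `n ≥ 1`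
and every `ω ∈ M n`. -/
theorem generalized_stein_direct {d : ℕ} (σ : Matrix (Fin d) (Fin d) ℂ)
    (M : ∀ n : ℕ, Set (Matrix (Fin n → Fin d) (Fin n → Fin d) ℂ))
    (hM : GoodFamily σ M)
    (ρ : Matrix (Fin d) (Fin d) ℂ) (hρ : IsState ρ)
    (E : ℝ)
    (hE : Filter.Tendsto (fun n : ℕ => EMset (M n) (tpow ρ n) / n) Filter.atTop (nhds E))
    (ε : ℝ) (hε : 0 < ε) :
    ∃ A : ∀ n : ℕ, Matrix (Fin n → Fin d) (Fin n → Fin d) ℂ,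
      (∀ n, (A n).PosSemidef ∧ (1 - A n).PosSemidef) ∧
      Filter.Tendsto (fun n : ℕ => (((1 - A n) * tpow ρ n).trace).re)
        Filter.atTop (nhds 0) ∧
      ∀ n : ℕ, 0 < n → ∀ ω ∈ M n,
        E ≤ -Real.logb 2 (((A n * ω).trace).re) / n + ε := by
  rcases le_or_gt E ε with hEε | hEε
  · refine ⟨fun n => 1, fun n => one_mem_tests, by simp, fun n _ ω hω => ?_⟩
    simpa [(hM.states n ω hω).2] using hEε
  set r := E - ε / 2 with hr
  have hr0 : 0 < r := by linarith
  obtain ⟨e, he, hdist⟩ := exists_tendsto_zero_of_eventually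
    (P := fun n η => Distinguishable (M n) (tpow ρ n) ((2 : ℝ) ^ ((n : ℝ) * r)) η)
    (fun n η η' h hP => hP.mono (hM.states n) le_rfl h)
    (fun n => Distinguishable.one _ _ _)
    (fun η hη => eventually_distinguishable hM hρ hE hr0 (by linarith) hη)
  choose A hA hAω using hdist
  have hlarge : ∀ᶠ n : ℕ in atTop, e n ≤ 1 ∧ 1 ≤ (n : ℝ) * (ε / 2) :=
    (he.eventually (ge_mem_nhds zero_lt_one)).and
      ((tendsto_natCast_atTop_atTop.atTop_mul_const (half_pos hε)).eventually_ge_atTop 1)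
  obtain ⟨N, hN⟩ := eventually_atTop.1 hlarge
  set c : ℕ → ℝ := fun n => (2 : ℝ) ^ (-((n : ℝ) * r)) with hc
  have hc0 : ∀ n, 0 < c n := fun n => by positivity
  have hc1 : ∀ n, c n ≤ 1 := fun n =>
    Real.rpow_le_one_of_one_le_of_nonpos one_le_two (neg_nonpos.2 (by positivity))
  have hlc : ∀ n : ℕ, (2 : ℝ) ^ ((n : ℝ) * r) * c n = 1 := fun n => by
    rw [hc, ← Real.rpow_add two_pos, add_neg_cancel, Real.rpow_zero]
  have hx : ∀ n, ∀ ω ∈ M n, 0 ≤ expect ω (A n) := fun n ω hω =>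
    expect_nonneg (hA n).1 (hM.states n ω hω).1
  have hρ1 : ∀ n, expect (tpow ρ n) (A n) ≤ 1 := fun n =>
    (expect_le (hA n).2 (hρ.tpow n).1).trans_eq (expect_one (hρ.tpow n))
  have hbig : ∀ n, (1 - c n) • A n + c n • 1 ∈ tests (Fin n → Fin d) := fun n =>
    convex_tests (hA n) one_mem_tests (sub_nonneg.2 (hc1 n)) (hc0 n).le (sub_add_cancel _ _)
  have hsmall : ∀ n : ℕ, (1 - (2 : ℝ) ^ (-((n : ℝ) * E))) • 0 + (2 : ℝ) ^ (-((n : ℝ) * E)) • 1 ∈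
      tests (Fin n → Fin d) := fun n => by
    have hE0 : 0 < E := hε.trans hEε
    exact convex_tests zero_mem_tests one_mem_tests
      (sub_nonneg.2 (Real.rpow_le_one_of_one_le_of_nonpos one_le_two
        (neg_nonpos.2 (by positivity)))) (by positivity) (sub_add_cancel _ _)
  refine ⟨fun n => if N ≤ n then (1 - c n) • A n + c n • 1 else
    (1 - (2 : ℝ) ^ (-((n : ℝ) * E))) • 0 + (2 : ℝ) ^ (-((n : ℝ) * E)) • 1, fun n => ?_, ?_,
    fun n hn ω hω => ?_⟩
  · dsimp only
    split_ifs
    exacts [hbig n, hsmall n]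
  · refine squeeze_zero' ?_ ?_ he
    · filter_upwards [eventually_ge_atTop N] with n hn
      rw [if_pos hn]
      exact expect_nonneg (hbig n).2 (hρ.tpow n).1
    · filter_upwards [eventually_ge_atTop N] with n hn
      rw [if_pos hn, ← expect_apply]
      simp only [map_sub, map_add, map_smul, expect_one (hρ.tpow n), smul_eq_mul]
      have h1 := hAω n _ (hM.sigma_mem n)
      have h2 := mul_nonneg (by positivity : (0 : ℝ) ≤ (2 : ℝ) ^ ((n : ℝ) * r))
        (hx n _ (hM.sigma_mem n))
      have h3 := mul_nonneg (hc0 n).le (sub_nonneg.2 (hρ1 n))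
      linarith
  · have hn0 : (0 : ℝ) < n := Nat.cast_pos.2 hn
    have hω1 := expect_one (hM.states n ω hω)
    dsimp only
    rw [← expect_apply, ← sub_le_iff_le_add, le_div_iff₀ hn0]
    split_ifs with hNn
    · obtain ⟨he1, hnε⟩ := hN n hNn
      simp only [map_add, map_smul, hω1, smul_eq_mul, mul_one]
      have h0 := hx n ω hω
      have h1 : expect ω (A n) ≤ c n := by
        have h := (hAω n ω hω).trans (sub_le_sub_right (hρ1 n) _)
        have h2 : (2 : ℝ) ^ ((n : ℝ) * r) * expect ω (A n) ≤ 1 := by linarith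
        have h3 := mul_le_mul_of_nonneg_left h2 (hc0 n).le
        rwa [← mul_assoc, mul_comm (c n), hlc, one_mul, mul_one] at h3
      have hpos : 0 < (1 - c n) * expect ω (A n) + c n :=
        add_pos_of_nonneg_of_pos (mul_nonneg (sub_nonneg.2 (hc1 n)) h0) (hc0 n)
      have hle : (1 - c n) * expect ω (A n) + c n ≤ (2 : ℝ) ^ (1 - (n : ℝ) * r) := by
        have h2 : (2 : ℝ) ^ (1 - (n : ℝ) * r) = 2 * c n := by
          rw [sub_eq_add_neg, Real.rpow_add two_pos, Real.rpow_one]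
        have := mul_nonneg (hc0 n).le h0
        linarith
      have := (Real.logb_le_iff_le_rpow one_lt_two hpos).2 hle
      have h4 : (n : ℝ) * r = (E - ε) * n + n * (ε / 2) := by rw [hr]; ring
      linarith
    · simp only [map_smul, smul_zero, zero_add, hω1, smul_eq_mul, mul_one]
      rw [Real.logb_rpow two_pos (by norm_num), neg_neg]
      nlinarith

end GQSL
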